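/- arXiv:2502.20800 — 4 statements merged into one kernel-verified Lean document; each statement's English description precedes it below -/
import Mathlib

section
/- Let G be the simple group of order 168 (realized as PSL(2,7) acting on 8 points, generated by (3,6,7)(4,5,8) and (1,8,2)(4,5,6)). Let C₇ be the cyclic subgroup generated by a = (1,8,2,4,3,7,5), and let χ₁ be the character of C₇ of degree 1 with χ₁(a) = ζ₇ (a primitive 7th root of unity). Let D₄ be the subgroup generated by r = (1,7,3,8)(2,6,4,5) and s = (1,2)(3,4)(5,7)(6,8) (a dihedral group of order 8), and let η be the degree-1 character of D₄ with η(r) = η(s) = −1. Then the irreducible character χ₂ of G of degree 3 satisfies χ₂ = Ind_{C₇}^G(χ₁) − Ind_{D₄}^G(η). -/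
open scoped Classical

/-- Induction of a class function `ψ` on a subgroup `H` of `G` to `G`:
`(Ind_H^G ψ)(g) = |H|⁻¹ ∑_{x ∈ G, x⁻¹gx ∈ H} ψ(x⁻¹gx)`. -/
noncomputable def indChar {G : Type} [Group G] [Fintype G] {K : Type} [Field K]
    (H : Subgroup G) (ψ : H → K) (g : G) : K :=
  (Fintype.card H : K)⁻¹ * ∑ x : G, if h : x⁻¹ * g * x ∈ H then ψ ⟨x⁻¹ * g * x, h⟩ else 0

section Aux
open Equiv

/-! ### Concrete permutations and their numerical codes -/

def pX : Perm (Fin 9) := c[(3 : Fin 9), 6, 7] * c[(4 : Fin 9), 5, 8]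
def pY : Perm (Fin 9) := c[(1 : Fin 9), 8, 2] * c[(4 : Fin 9), 5, 6]
def pA : Perm (Fin 9) := c[(1 : Fin 9), 8, 2, 4, 3, 7, 5]
def pR : Perm (Fin 9) := c[(1 : Fin 9), 7, 3, 8] * c[(2 : Fin 9), 6, 4, 5]
def pS : Perm (Fin 9) :=
  c[(1 : Fin 9), 2] * c[(3 : Fin 9), 4] * c[(5 : Fin 9), 7] * c[(6 : Fin 9), 8]
def pC : Perm (Fin 9) := c[(1 : Fin 9), 5, 3, 7, 6, 8, 2]
def pB : Perm (Fin 9) := pX * pX * pY * pX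

/-- hexadecimal code of a permutation -/
def code (g : Perm (Fin 9)) : ℕ :=
  (g 0).val + 16 * ((g 1).val + 16 * ((g 2).val + 16 * ((g 3).val + 16 * ((g 4).val
    + 16 * ((g 5).val + 16 * ((g 6).val + 16 * ((g 7).val + 16 * (g 8).val)))))))

/-- the `i`-th hexadecimal digit -/
def dig (c i : ℕ) : ℕ := c / 16 ^ i % 16

/-- composition of codes -/
def comp (c d : ℕ) : ℕ :=
  dig c (dig d 0) + 16 * (dig c (dig d 1) + 16 * (dig c (dig d 2) + 16 * (dig c (dig d 3)
    + 16 * (dig c (dig d 4) + 16 * (dig c (dig d 5) + 16 * (dig c (dig d 6)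
    + 16 * (dig c (dig d 7) + 16 * dig c (dig d 8))))))))

theorem dig_code (g : Perm (Fin 9)) (i : Fin 9) : dig (code g) i.val = (g i).val := by
  have h0 := (g 0).isLt
  have h1 := (g 1).isLt
  have h2 := (g 2).isLt
  have h3 := (g 3).isLt
  have h4 := (g 4).isLt
  have h5 := (g 5).isLt
  have h6 := (g 6).isLt
  have h7 := (g 7).isLt
  have h8 := (g 8).isLt
  unfold dig code
  fin_cases i <;> simp <;> omega

theorem code_mul (g h : Perm (Fin 9)) : code (g * h) = comp (code g) (code h) := by
  have hd : ∀ i : Fin 9, dig (code g) (dig (code h) i.val) = ((g * h) i).val := by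
    intro i
    rw [dig_code, dig_code]; rfl
  have e0 := hd 0
  have e1 := hd 1
  have e2 := hd 2
  have e3 := hd 3
  have e4 := hd 4
  have e5 := hd 5
  have e6 := hd 6
  have e7 := hd 7
  have e8 := hd 8
  simp only [Fin.isValue, Fin.coe_ofNat_eq_mod, Nat.reduceMod] at e0 e1 e2 e3 e4 e5 e6 e7 e8
  unfold comp
  rw [e0, e1, e2, e3, e4, e5, e6, e7, e8]
  rfl

theorem code_inj {g h : Perm (Fin 9)} (e : code g = code h) : g = h := by
  ext i
  rw [← dig_code, ← dig_code, e]

def cX : ℕ := 18111357456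
def cY : ℕ := 10542723456
def cA : ℕ := 10034050176
def cB : ℕ := 19161907536
def cR : ℕ := 5169841776
def cS : ℕ := 27253752096
def cC : ℕ := 10338201936
def c1 : ℕ := 36344967696

theorem code_X : code pX = cX := by decide +kernel
theorem code_Y : code pY = cY := by decide +kernel
theorem code_A : code pA = cA := by decide +kernel
theorem code_B : code pB = cB := by decide +kernel
theorem code_R : code pR = cR := by decide +kernel
theorem code_S : code pS = cS := by decide +kernel
theorem code_C : code pC = cC := by decide +kernel
theorem code_1 : code 1 = c1 := by decide +kernel

/-- power of a code -/
def pw (c : ℕ) : ℕ → ℕ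
  | 0 => c1
  | n + 1 => comp (pw c n) c

theorem code_pow (g : Perm (Fin 9)) (n : ℕ) : code (g ^ n) = pw (code g) n := by
  induction n with
  | zero => exact code_1
  | succ n ih => rw [pow_succ, code_mul, ih]; rfl

/-- the 168 elements of the group -/
def el (p : ℕ) : Perm (Fin 9) :=
  pA ^ (p / 24) * pB ^ (p / 8 % 3) * (pR ^ (p / 2 % 4) * pS ^ (p % 2))

def ec (p : ℕ) : ℕ :=
  comp (comp (pw cA (p / 24)) (pw cB (p / 8 % 3))) (comp (pw cR (p / 2 % 4)) (pw cS (p % 2)))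

theorem code_el (p : ℕ) : code (el p) = ec p := by
  simp only [el, ec, code_mul, code_pow, code_A, code_B, code_R, code_S]

/-- bounded universal quantifier, as a Boolean -/
def allb (f : ℕ → Bool) : ℕ → Bool
  | 0 => true
  | n + 1 => f n && allb f n

theorem allb_spec {f : ℕ → Bool} {n : ℕ} (h : allb f n = true) : ∀ p < n, f p = true := by
  induction n with
  | zero => intro p hp; omega
  | succ n ih =>
    simp only [allb, Bool.and_eq_true] at h
    intro p hp
    rcases Nat.lt_succ_iff_lt_or_eq.mp hp with h1 | h1
    · exact ih h.2 p h1
    · rw [h1]; exact h.1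

/-- bounded counting -/
def cnt (f : ℕ → Bool) : ℕ → ℕ
  | 0 => 0
  | n + 1 => cnt f n + (f n).toNat

theorem sum_cnt (f : ℕ → Bool) (z : ℂ) (n : ℕ) :
    (∑ p ∈ Finset.range n, if f p = true then z else 0) = (cnt f n : ℂ) * z := by
  induction n with
  | zero => simp [cnt]
  | succ n ih =>
    rw [Finset.sum_range_succ, ih, cnt]
    cases f n <;> simp [add_mul]

/-- class index of each element -/
def clIdx (p : ℕ) : ℕ :=
  352124324245353222343125224313522332211245232345213223123521243234525234323545421122332232424535545432323434525253232454132231222353124221353224431352225213432213111310 / 10 ^ p % 10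

/-- a conjugating element, by index -/
def cjIdx (p : ℕ) : ℕ :=
  89007003026071001064029062026015046161029144120004020049006097098066000009001007073058056005053046112113047055114074072036013019137010145046016050048128043042129090077048003007034059005121024104038014031062058032008136114033038022036026101016008011018040041034144009022023035013010105008015012022010008119017125025029160021026038023096021024015016063014012016032080023039081024014149044065006152066002004048006122072002120041095000003153010096001090012005004062018057002088017000072001002042050000000000 / 1000 ^ p % 1000

/-- left multiplication by `pX`, on indices -/
def lxIdx (p : ℕ) : ℕ :=
  6007000001002003004005014015008009010011012013022023016017018019020021049048055054053052051050156157158159152153154155083082081080087086085084139138137136143142141140033032039038037036035034092093094095088089090091077076075074073072079078064065066067068069070071098099100101102103096097124125126127120121122123147146145144151150149148113112119118117116115114104105106107108109110111042043044045046047040041165164163162161160167166058059060061062063056057133132131130129128135134024025026027028029030031 / 1000 ^ p % 1000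

/-- left multiplication by `pY`, on indices -/
def lyIdx (p : ℕ) : ℕ :=
  35034033032039038037036001000007006005004003002108109110111104105106107117116115114113112119118056057058059060061062063162163164165166167160161044045046047040041042043091090089088095094093092153152159158157156155154144145146147148149150151010011012013014015008009085084083082081080087086050051052053054055048049029028027026025024031030016017018019020021022023142143136137138139140141126127120121122123124125134135128129130131132133065064071070069068067066076077078079072073074075099098097096103102101100 / 1000 ^ p % 1000

/-- class representatives, as indices: `1, s, b, r, a, a⁻¹` -/
def rp : ℕ → ℕ
  | 0 => 0
  | 1 => 1
  | 2 => 8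
  | 3 => 2
  | 4 => 24
  | _ => 144

theorem chk_x : allb (fun p => decide (lxIdx p < 168) && Nat.beq (comp cX (ec p)) (ec (lxIdx p))) 168
    = true := by decide +kernel
theorem chk_y : allb (fun p => decide (lyIdx p < 168) && Nat.beq (comp cY (ec p)) (ec (lyIdx p))) 168
    = true := by decide +kernel
theorem chk_cj : allb (fun p => decide (clIdx p < 6) && (decide (cjIdx p < 168) &&
    Nat.beq (comp (ec p) (ec (cjIdx p))) (comp (ec (cjIdx p)) (ec (rp (clIdx p)))))) 168
    = true := by decide +kernel
theorem chk_inj : allb (fun p => allb (fun q => !(Nat.beq (ec p) (ec q))) p) 168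
    = true := by decide +kernel

def tabA (k i : ℕ) : ℕ := cnt (fun q => Nat.beq (comp (ec (rp k)) (ec q)) (comp (ec q) (pw cA i))) 168
def tabD (k i : ℕ) : ℕ :=
  cnt (fun q => Nat.beq (comp (ec (rp k)) (ec q))
    (comp (ec q) (comp (pw cR (i / 2)) (pw cS (i % 2))))) 168

theorem chk_tabA : (List.range 6).map (fun k => (List.range 7).map (tabA k)) =
  [[168, 0, 0, 0, 0, 0, 0], [0, 0, 0, 0, 0, 0, 0], [0, 0, 0, 0, 0, 0, 0], [0, 0, 0, 0, 0, 0, 0],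
   [0, 7, 7, 0, 7, 0, 0], [0, 0, 0, 7, 0, 7, 7]] := by decide +kernel
theorem chk_tabD : (List.range 6).map (fun k => (List.range 8).map (tabD k)) =
  [[168, 0, 0, 0, 0, 0, 0, 0], [0, 8, 0, 8, 8, 8, 0, 8], [0, 0, 0, 0, 0, 0, 0, 0],
   [0, 0, 4, 0, 0, 0, 4, 0], [0, 0, 0, 0, 0, 0, 0, 0], [0, 0, 0, 0, 0, 0, 0, 0]] := by
  decide +kernel
theorem chk_cl : (List.range 6).map (fun k => cnt (fun p => Nat.beq (clIdx p) k) 168) =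
    [1, 21, 56, 42, 24, 24] := by decide +kernel

theorem el_conj {g h : Perm (Fin 9)} (q : ℕ) (e : comp (code g) (ec q) = comp (ec q) (code h)) :
    g * el q = el q * h := by
  apply code_inj
  rw [code_mul, code_mul, code_el, e]

/-! ### The group, class sums and induced characters -/

theorem mem_el {G : Subgroup (Perm (Fin 9))} (hG : G = Subgroup.closure {pX, pY})
    {g : Perm (Fin 9)} (hg : g ∈ G) : ∃ p < 168, g = el p := by
  have hx : ∀ p < 168, ∃ q < 168, pX * el p = el q := by
    intro p hp
    have := allb_spec chk_x p hp
    simp only [Bool.and_eq_true, decide_eq_true_eq, Nat.beq_eq] at this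
    refine ⟨_, this.1, code_inj ?_⟩
    rw [code_mul, code_el, code_el, code_X, this.2]
  have hy : ∀ p < 168, ∃ q < 168, pY * el p = el q := by
    intro p hp
    have := allb_spec chk_y p hp
    simp only [Bool.and_eq_true, decide_eq_true_eq, Nat.beq_eq] at this
    refine ⟨_, this.1, code_inj ?_⟩
    rw [code_mul, code_el, code_el, code_Y, this.2]
  have hxi : pX⁻¹ = pX * pX := by
    rw [inv_eq_iff_mul_eq_one]
    apply code_inj
    rw [code_mul, code_mul, code_X, code_1]
    decide +kernel
  have hyi : pY⁻¹ = pY * pY := by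
    rw [inv_eq_iff_mul_eq_one]
    apply code_inj
    rw [code_mul, code_mul, code_Y, code_1]
    decide +kernel
  rw [hG] at hg
  induction hg using Subgroup.closure_induction_left with
  | one =>
    refine ⟨0, by norm_num, code_inj ?_⟩
    rw [code_1, code_el]
    decide +kernel
  | mul_left x hx' y _ ih =>
    obtain ⟨p, hp, rfl⟩ := ih
    rcases hx' with rfl | rfl
    · exact hx p hp
    · exact hy p hp
  | inv_mul_cancel x hx' y _ ih =>
    obtain ⟨p, hp, rfl⟩ := ih
    rcases hx' with rfl | rfl
    · obtain ⟨q, hq, e⟩ := hx p hp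
      rw [hxi, mul_assoc, e]
      exact hx q hq
    · obtain ⟨q, hq, e⟩ := hy p hp
      rw [hyi, mul_assoc, e]
      exact hy q hq

theorem el_inj {p q : ℕ} (hp : p < 168) (hq : q < 168) (e : el p = el q) : p = q := by
  have key : ∀ p < 168, ∀ q < p, el p ≠ el q := by
    intro p hp q hq e
    have := allb_spec (allb_spec chk_inj p hp) q hq
    rw [← code_el, ← code_el, e] at this
    simp at this
  rcases lt_trichotomy p q with h | h | h
  · exact absurd e.symm (key q hq p h)
  · exact h
  · exact absurd e (key p hp q h)

theorem sum_el {G : Subgroup (Perm (Fin 9))} [Fintype G] (hG : G = Subgroup.closure {pX, pY})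
    (hel : ∀ p, el p ∈ G) (f : G → ℂ) :
    ∑ x : G, f x = ∑ p ∈ Finset.range 168, f ⟨el p, hel p⟩ := by
  symm
  apply Finset.sum_bij (fun p _ => (⟨el p, hel p⟩ : G))
  · intros; exact Finset.mem_univ _
  · intro p hp q hq e
    exact el_inj (Finset.mem_range.1 hp) (Finset.mem_range.1 hq) (congrArg Subtype.val e)
  · rintro ⟨g, hg⟩ _
    obtain ⟨p, hp, rfl⟩ := mem_el hG hg
    exact ⟨p, Finset.mem_range.2 hp, rfl⟩
  · intros; rfl

theorem conj_rep {p : ℕ} (hp : p < 168) :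
    clIdx p < 6 ∧ el p * el (cjIdx p) = el (cjIdx p) * el (rp (clIdx p)) := by
  have := allb_spec chk_cj p hp
  simp only [Bool.and_eq_true, decide_eq_true_eq, Nat.beq_eq] at this
  refine ⟨this.1, el_conj _ ?_⟩
  rw [code_el, code_el, this.2.2]

theorem class_sum {G : Subgroup (Perm (Fin 9))} [Fintype G] (hG : G = Subgroup.closure {pX, pY})
    (hel : ∀ p, el p ∈ G) (f : G → ℂ) (hf : ∀ g x h : G, g * x = x * h → f g = f h) :
    ∑ x : G, f x = f ⟨el 0, hel 0⟩ + 21 * f ⟨el 1, hel 1⟩ + 56 * f ⟨el 8, hel 8⟩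
      + 42 * f ⟨el 2, hel 2⟩ + 24 * f ⟨el 24, hel 24⟩ + 24 * f ⟨el 144, hel 144⟩ := by
  rw [sum_el hG hel]
  have h1 : ∀ p ∈ Finset.range 168, f ⟨el p, hel p⟩ =
      ∑ k ∈ Finset.range 6, if Nat.beq (clIdx p) k = true then f ⟨el (rp k), hel _⟩ else 0 := by
    intro p hp
    obtain ⟨h6, hc⟩ := conj_rep (Finset.mem_range.1 hp)
    simp only [Nat.beq_eq]
    rw [Finset.sum_ite_eq, if_pos (Finset.mem_range.2 h6)]
    exact hf _ ⟨el (cjIdx p), hel _⟩ _ (Subtype.ext hc)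
  rw [Finset.sum_congr rfl h1, Finset.sum_comm]
  simp only [sum_cnt]
  have h2 := chk_cl
  simp only [List.range, List.range.loop, List.map, List.cons.injEq] at h2
  obtain ⟨a0, a1, a2, a3, a4, a5, _⟩ := h2
  simp only [Finset.sum_range_succ, Finset.sum_range_zero, a0, a1, a2, a3, a4, a5, rp]
  push_cast
  ring

theorem indChar_conj {G : Type} [Group G] [Fintype G] (H : Subgroup G) (ψ : H → ℂ)
    (g x h : G) (e : g * x = x * h) : indChar H ψ g = indChar H ψ h := by
  unfold indChar
  congr 1
  rw [← Equiv.sum_comp (Equiv.mulLeft x)]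
  apply Finset.sum_congr rfl
  intro y _
  have : (Equiv.mulLeft x y)⁻¹ * g * Equiv.mulLeft x y = y⁻¹ * h * y := by
    simp only [Equiv.coe_mulLeft, mul_inv_rev]
    have : g = x * h * x⁻¹ := by rw [← e]; group
    rw [this]; group
  simp only [this]

theorem ind_formula {G : Type} [Group G] [Fintype G] (H : Subgroup G) (ψ : H → ℂ) (n : ℕ)
    (h : ℕ → G) (hinj : ∀ i < n, ∀ j < n, h i = h j → i = j) (hmem : ∀ i, h i ∈ H)
    (hsurj : ∀ x ∈ H, ∃ i < n, x = h i) (v : ℕ → ℂ) (hv : ∀ i, ψ ⟨h i, hmem i⟩ = v i) (g : G) :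
    indChar H ψ g =
      (n : ℂ)⁻¹ * ∑ i ∈ Finset.range n, ∑ x : G, if g * x = x * h i then v i else 0 := by
  have hcard : Fintype.card H = n := by
    rw [← Finset.card_univ, ← Finset.card_range n]
    symm
    apply Finset.card_bij (fun i _ => (⟨h i, hmem i⟩ : H))
    · intros; exact Finset.mem_univ _
    · intro i hi j hj e
      exact hinj i (Finset.mem_range.1 hi) j (Finset.mem_range.1 hj) (congrArg Subtype.val e)
    · rintro ⟨x, hx⟩ _
      obtain ⟨i, hi, rfl⟩ := hsurj x hx
      exact ⟨i, Finset.mem_range.2 hi, rfl⟩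
  unfold indChar
  rw [hcard, Finset.sum_comm]
  congr 1
  apply Finset.sum_congr rfl
  intro x _
  have hiff : ∀ i, g * x = x * h i ↔ x⁻¹ * g * x = h i := by
    intro i
    rw [mul_assoc, inv_mul_eq_iff_eq_mul]
  simp only [hiff]
  split_ifs with hx
  · obtain ⟨i, hi, e⟩ := hsurj _ hx
    rw [Finset.sum_eq_single i]
    · rw [if_pos e, ← hv]
      congr 1
      exact Subtype.ext e
    · intro j hj hne
      rw [if_neg]
      intro e'
      exact hne (hinj j (Finset.mem_range.1 hj) i hi (e'.symm.trans e))
    · intro hn; exact absurd (Finset.mem_range.2 hi) hn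
  · symm
    apply Finset.sum_eq_zero
    intro i _
    rw [if_neg]
    intro e
    exact hx (e ▸ hmem i)

theorem char_avg {G : Type} [Group G] (V : FDRep ℂ G) (g : G) (n : ℕ) (hn : 0 < n)
    (hg : g ^ n = 1) : ∃ k : ℕ, ∑ i ∈ Finset.range n, V.character (g ^ i) = n * k := by
  set P : Module.End ℂ V := V.ρ g with hP
  have hPn : P ^ n = 1 := by rw [hP, ← map_pow, hg, map_one]
  set S : Module.End ℂ V := ∑ i ∈ Finset.range n, P ^ i with hS
  have hPS : P * S = S := by
    have := mul_neg_geom_sum P n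
    rw [hPn, sub_self, sub_mul, one_mul, sub_eq_zero] at this
    exact this.symm
  have hPiS : ∀ i, P ^ i * S = S := by
    intro i
    induction i with
    | zero => simp
    | succ i ih => rw [pow_succ, mul_assoc, hPS, ih]
  have hSS : S * S = (n : ℂ) • S := by
    conv_lhs => rw [hS, Finset.sum_mul]
    rw [Finset.sum_congr rfl (fun i _ => hPiS i), Finset.sum_const, Finset.card_range,
      Nat.cast_smul_eq_nsmul]
  have hn0 : (n : ℂ) ≠ 0 := by exact_mod_cast hn.ne'
  have hid : IsIdempotentElem ((n : ℂ)⁻¹ • S) := by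
    unfold IsIdempotentElem
    rw [smul_mul_smul_comm, hSS, smul_smul]
    congr 1
    field_simp
  have ht := (LinearMap.IsIdempotentElem.isProj_range _ hid).trace
  refine ⟨Module.finrank ℂ (LinearMap.range ((n : ℂ)⁻¹ • S)), ?_⟩
  · rw [← ht, map_smul, smul_eq_mul, ← mul_assoc, mul_inv_cancel₀ hn0, one_mul, hS, map_sum]
    apply Finset.sum_congr rfl
    intro i _
    rw [FDRep.character, map_pow]

theorem ite_iff_congr {b c : Prop} {ib : Decidable b} {ic : Decidable c} (z : ℂ) (h : b ↔ c) :
    (if b then z else 0) = if c then z else 0 := by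
  by_cases hb : b
  · rw [if_pos hb, if_pos (h.1 hb)]
  · rw [if_neg hb, if_neg (fun hc => hb (h.2 hc))]

theorem gauss7 (ζ : ℂ) (hζ : ζ = Complex.exp (2 * Real.pi * Complex.I / 7)) :
    1 + ζ + ζ ^ 2 + ζ ^ 3 + ζ ^ 4 + ζ ^ 5 + ζ ^ 6 = 0 ∧
    ζ + ζ ^ 2 + ζ ^ 4 = (-1 + Real.sqrt 7 * Complex.I) / 2 := by
  have hprim : IsPrimitiveRoot ζ 7 := by
    rw [hζ]; exact_mod_cast Complex.isPrimitiveRoot_exp 7 (by norm_num)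
  have h7 : ζ ^ 7 = 1 := hprim.pow_eq_one
  have h0 : 1 + ζ + ζ ^ 2 + ζ ^ 3 + ζ ^ 4 + ζ ^ 5 + ζ ^ 6 = 0 := by
    have := hprim.geom_sum_eq_zero (by norm_num)
    simp only [Finset.sum_range_succ, Finset.sum_range_zero] at this
    linear_combination this
  refine ⟨h0, ?_⟩
  have hs : ((Real.sqrt 7 : ℝ) : ℂ) ^ 2 = 7 := by
    rw [← Complex.ofReal_pow, Real.sq_sqrt (by norm_num)]; norm_num
  have hq : (2 * (ζ + ζ ^ 2 + ζ ^ 4) + 1 - Real.sqrt 7 * Complex.I) *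
      (2 * (ζ + ζ ^ 2 + ζ ^ 4) + 1 + Real.sqrt 7 * Complex.I) = 0 := by
    linear_combination 8 * h0 + 4 * ζ * h7 - ((Real.sqrt 7 : ℝ) : ℂ) ^ 2 * Complex.I_sq + hs
  have him : 0 < (ζ + ζ ^ 2 + ζ ^ 4).im := by
    have hp : ∀ n : ℕ, (ζ ^ n).im = Real.sin (n * (2 * Real.pi / 7)) := by
      intro n
      rw [hζ, ← Complex.exp_nat_mul]
      have : (n : ℂ) * (2 * Real.pi * Complex.I / 7) =
          ((n * (2 * Real.pi / 7) : ℝ) : ℂ) * Complex.I := by push_cast; ring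
      rw [this, Complex.exp_ofReal_mul_I_im]
    have e1 := hp 1
    rw [pow_one] at e1
    rw [Complex.add_im, Complex.add_im, e1, hp 2, hp 4]
    have hpi := Real.pi_pos
    have s1 : 0 < Real.sin ((1 : ℕ) * (2 * Real.pi / 7)) := by
      apply Real.sin_pos_of_pos_of_lt_pi <;> push_cast <;> linarith
    have s2 : Real.sin ((2 : ℕ) * (2 * Real.pi / 7)) = Real.sin (3 * Real.pi / 7) := by
      rw [← Real.sin_pi_sub]; congr 1; push_cast; ring
    have s4 : Real.sin ((4 : ℕ) * (2 * Real.pi / 7)) = - Real.sin (Real.pi / 7) := by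
      rw [← Real.sin_add_pi]; congr 1; push_cast; ring
    have s3 : Real.sin (Real.pi / 7) < Real.sin (3 * Real.pi / 7) := by
      apply Real.sin_lt_sin_of_lt_of_le_pi_div_two <;> linarith
    rw [s2, s4]
    linarith
  rcases mul_eq_zero.mp hq with h | h
  · linear_combination h / 2
  · exfalso
    have h2 := congrArg Complex.im h
    have h3 : 0 < Real.sqrt 7 := Real.sqrt_pos.mpr (by norm_num)
    have e2 : (2 * (ζ + ζ ^ 2 + ζ ^ 4) + 1 + Real.sqrt 7 * Complex.I).im =
      2 * (ζ + ζ ^ 2 + ζ ^ 4).im + Real.sqrt 7 := by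
      rw [Complex.add_im, Complex.add_im, Complex.mul_im]
      simp
    rw [e2] at h2
    simp only [Complex.zero_im] at h2
    linarith

theorem el_24 {i : ℕ} (_ : i < 7) : pA ^ i = el (24 * i) := by
  have h1 : 24 * i / 24 = i := by omega
  have h2 : 24 * i / 8 % 3 = 0 := by omega
  have h3 : 24 * i / 2 % 4 = 0 := by omega
  have h4 : 24 * i % 2 = 0 := by omega
  simp [el, h1, h2, h3, h4]

theorem el_8 {i : ℕ} (hi : i < 8) : pR ^ (i / 2) * pS ^ (i % 2) = el i := by
  have h1 : i / 24 = 0 := by omega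
  have h2 : i / 8 % 3 = 0 := by omega
  have h3 : i / 2 % 4 = i / 2 := by omega
  simp [el, h1, h2, h3]

theorem pA7 : pA ^ 7 = 1 := by
  apply code_inj
  rw [code_pow, code_A, code_1]
  decide +kernel

theorem indA {G : Subgroup (Perm (Fin 9))} [Fintype G] (hG : G = Subgroup.closure {pX, pY})
    (hel : ∀ p, el p ∈ G) (a : G) (ha : (a : Perm (Fin 9)) = pA) (ζ : ℂ)
    (χ₁ : (Subgroup.zpowers a : Subgroup G) →* ℂ)
    (hχ₁ : χ₁ ⟨a, Subgroup.mem_zpowers a⟩ = ζ) (k : ℕ) :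
    indChar (Subgroup.zpowers a) χ₁ ⟨el (rp k), hel _⟩ =
      (7 : ℂ)⁻¹ * ∑ i ∈ Finset.range 7, (tabA k i : ℂ) * ζ ^ i := by
  have ha7 : a ^ 7 = 1 := by
    apply Subtype.ext
    rw [Subgroup.coe_pow, ha, pA7]; rfl
  have hmem : ∀ i : ℕ, a ^ i ∈ Subgroup.zpowers a := fun i =>
    Subgroup.pow_mem _ (Subgroup.mem_zpowers a) i
  rw [ind_formula (Subgroup.zpowers a) χ₁ 7 (fun i => a ^ i) ?_ hmem ?_ (fun i => ζ ^ i) ?_]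
  · push_cast
    congr 1
    apply Finset.sum_congr rfl
    intro i _
    rw [sum_el hG hel, tabA, ← sum_cnt]
    apply Finset.sum_congr rfl
    intro p _
    refine ite_iff_congr _ ?_
    rw [Nat.beq_eq, ← code_el, ← code_el, ← code_A, ← code_pow, ← code_mul, ← code_mul]
    constructor
    · intro h
      have := congrArg Subtype.val h
      simp only [Subgroup.coe_mul, Subgroup.coe_pow, ha] at this
      rw [this]
    · intro h
      apply Subtype.ext
      simp only [Subgroup.coe_mul, Subgroup.coe_pow, ha]
      exact code_inj h
  · intro i hi j hj h
    have := congrArg Subtype.val h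
    simp only [Subgroup.coe_pow, ha] at this
    rw [el_24 hi, el_24 hj] at this
    have := el_inj (by omega) (by omega) this
    omega
  · rintro x ⟨z, rfl⟩
    refine ⟨(z % 7).toNat, by omega, ?_⟩
    have h1 : a ^ z = a ^ (z % (7 : ℕ)) := zpow_eq_zpow_emod z ha7
    have h2 : a ^ (z % 7).toNat = a ^ (z % 7) := by
      rw [← zpow_natCast]
      congr 1
      omega
    simpa [h2] using h1
  · intro i
    rw [← hχ₁, ← map_pow]
    rfl

theorem indD {G : Subgroup (Perm (Fin 9))} [Fintype G] (hG : G = Subgroup.closure {pX, pY})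
    (hel : ∀ p, el p ∈ G) (r s : G) (hr : (r : Perm (Fin 9)) = pR) (hs : (s : Perm (Fin 9)) = pS)
    (hD4card : Nat.card (Subgroup.closure {r, s} : Subgroup G) = 8)
    (η : (Subgroup.closure {r, s} : Subgroup G) →* ℂ)
    (hηr : η ⟨r, Subgroup.subset_closure (Set.mem_insert _ _)⟩ = -1)
    (hηs : η ⟨s, Subgroup.subset_closure (Set.mem_insert_of_mem _ rfl)⟩ = -1) (k : ℕ) :
    indChar (Subgroup.closure {r, s}) η ⟨el (rp k), hel _⟩ =
      (8 : ℂ)⁻¹ * ∑ i ∈ Finset.range 8, (tabD k i : ℂ) * ((-1) ^ (i / 2) * (-1) ^ (i % 2)) := by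
  have hrm : r ∈ Subgroup.closure {r, s} := Subgroup.subset_closure (Set.mem_insert _ _)
  have hsm : s ∈ Subgroup.closure {r, s} :=
    Subgroup.subset_closure (Set.mem_insert_of_mem _ rfl)
  have hmem : ∀ i : ℕ, r ^ (i / 2) * s ^ (i % 2) ∈ Subgroup.closure {r, s} := fun i =>
    Subgroup.mul_mem _ (Subgroup.pow_mem _ hrm _) (Subgroup.pow_mem _ hsm _)
  have hinj : ∀ i < 8, ∀ j < 8,
      r ^ (i / 2) * s ^ (i % 2) = r ^ (j / 2) * s ^ (j % 2) → i = j := by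
    intro i hi j hj h
    have := congrArg Subtype.val h
    simp only [Subgroup.coe_mul, Subgroup.coe_pow, hr, hs] at this
    rw [el_8 hi, el_8 hj] at this
    exact el_inj (by omega) (by omega) this
  rw [ind_formula (Subgroup.closure {r, s}) η 8 (fun i => r ^ (i / 2) * s ^ (i % 2)) hinj hmem ?_
    (fun i => (-1) ^ (i / 2) * (-1) ^ (i % 2)) ?_]
  · push_cast
    congr 1
    apply Finset.sum_congr rfl
    intro i _
    rw [sum_el hG hel, tabD, ← sum_cnt]
    apply Finset.sum_congr rfl
    intro p _
    refine ite_iff_congr _ ?_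
    rw [Nat.beq_eq, ← code_el, ← code_el, ← code_R, ← code_S, ← code_pow, ← code_pow,
      ← code_mul, ← code_mul, ← code_mul]
    constructor
    · intro h
      have := congrArg Subtype.val h
      simp only [Subgroup.coe_mul, Subgroup.coe_pow, hr, hs] at this
      rw [this]
    · intro h
      apply Subtype.ext
      simp only [Subgroup.coe_mul, Subgroup.coe_pow, hr, hs]
      exact code_inj h
  · have hb : Function.Bijective (fun i : Fin 8 =>
        (⟨r ^ (i.val / 2) * s ^ (i.val % 2), hmem i⟩ : Subgroup.closure {r, s})) := by
      apply Function.Injective.bijective_of_nat_card_le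
      · intro i j h
        exact Fin.ext (hinj i i.isLt j j.isLt (congrArg Subtype.val h))
      · rw [hD4card]; simp
    intro x hx
    obtain ⟨i, hi⟩ := hb.2 ⟨x, hx⟩
    exact ⟨i, i.isLt, (congrArg Subtype.val hi).symm⟩
  · intro i
    rw [← hηr]
    nth_rewrite 2 [hηr]
    rw [← hηs, ← map_pow, ← map_pow, ← map_mul]
    rfl

/-- The arithmetic pinning down the character values. -/
theorem values_aux (x y z u w : ℂ) (k l m n t : ℕ)
    (hu : u = (-1 + Real.sqrt 7 * Complex.I) / 2)
    (h2 : 3 + x = 2 * k) (h3 : 3 + 2 * z = 3 * m) (h4 : 3 + x + 2 * y = 4 * l)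
    (h7 : 3 + 3 * u + 3 * w = 7 * n)
    (ho : 9 + 21 * x ^ 2 + 56 * z ^ 2 + 42 * y ^ 2 + 48 * (u * w) = 168)
    (ht : 3 + 21 * x + 56 * z + 42 * y + 24 * u + 24 * w = 168 * t) :
    x = -1 ∧ z = 0 ∧ y = 1 ∧ w = -1 - u := by
  have hs : ((Real.sqrt 7 : ℝ) : ℂ) ^ 2 = 7 := by
    rw [← Complex.ofReal_pow, Real.sq_sqrt (by norm_num)]; norm_num
  have hx : x = 2 * k - 3 := by linear_combination h2
  have hz : z = 3 * (m - 1) / 2 := by linear_combination h3 / 2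
  have hy : y = 2 * l - k := by linear_combination h4 / 2 - h2 / 2
  have hw : w = 7 * n / 3 - 1 - u := by linear_combination h7 / 3
  have huu : u ^ 2 + u + 2 = 0 := by
    rw [hu]
    linear_combination ((Real.sqrt 7 : ℝ) : ℂ) ^ 2 * Complex.I_sq / 4 - hs / 4
  have key : 21 * (2 * (k : ℂ) - 3) ^ 2 + 126 * ((m : ℂ) - 1) ^ 2 + 42 * (2 * (l : ℂ) - k) ^ 2
      + 112 * n * u = 63 := by
    rw [hx, hz, hy, hw] at ho
    linear_combination ho + 48 * huu
  have hn : n = 0 := by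
    have him := congrArg Complex.im key
    have e : (21 * (2 * (k : ℂ) - 3) ^ 2 + 126 * ((m : ℂ) - 1) ^ 2 + 42 * (2 * (l : ℂ) - k) ^ 2
      + 112 * n * u) = ((21 * (2 * (k : ℝ) - 3) ^ 2 + 126 * ((m : ℝ) - 1) ^ 2
        + 42 * (2 * (l : ℝ) - k) ^ 2 - 56 * n : ℝ) : ℂ) +
        ((56 * n * Real.sqrt 7 : ℝ) : ℂ) * Complex.I := by
      rw [hu]; push_cast; ring
    rw [e, Complex.add_im, Complex.ofReal_im, Complex.im_ofReal_mul, Complex.I_im] at him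
    have h3 : 0 < Real.sqrt 7 := Real.sqrt_pos.mpr (by norm_num)
    have : (63 : ℂ).im = 0 := by simp
    rw [this] at him
    have : (n : ℝ) * Real.sqrt 7 = 0 := by linarith
    rcases mul_eq_zero.mp this with h | h
    · exact_mod_cast h
    · linarith
  subst hn
  have kz : (2 * (k : ℤ) - 3) ^ 2 + 6 * ((m : ℤ) - 1) ^ 2 + 2 * (2 * (l : ℤ) - k) ^ 2 = 3 := by
    have : (2 * (k : ℂ) - 3) ^ 2 + 6 * ((m : ℂ) - 1) ^ 2 + 2 * (2 * (l : ℂ) - k) ^ 2 = 3 := by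
      push_cast at key
      linear_combination key / 21
    exact_mod_cast this
  have tz : 3 + 21 * (2 * (k : ℤ) - 3) + 84 * ((m : ℤ) - 1) + 42 * (2 * (l : ℤ) - k) - 24
      = 168 * t := by
    have : 3 + 21 * (2 * (k : ℂ) - 3) + 84 * ((m : ℂ) - 1) + 42 * (2 * (l : ℂ) - k) - 24
      = 168 * t := by
      rw [hx, hz, hy, hw] at ht
      push_cast at ht
      linear_combination ht
    exact_mod_cast this
  have hm : m = 1 := by
    have : ((m : ℤ) - 1) ^ 2 < 1 := by nlinarith [sq_nonneg (2 * (k : ℤ) - 3), sq_nonneg (2 * (l : ℤ) - k)]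
    have : (m : ℤ) - 1 = 0 := by
      rw [sq_lt_one_iff_abs_lt_one] at this
      exact Int.abs_lt_one_iff.mp this
    omega
  subst hm
  have hk1 : 2 * (k : ℤ) - 3 < 2 := by nlinarith [sq_nonneg (2 * (l : ℤ) - k)]
  have hk2 : -2 < 2 * (k : ℤ) - 3 := by nlinarith [sq_nonneg (2 * (l : ℤ) - k)]
  have hl1 : 2 * (l : ℤ) - k < 2 := by nlinarith [sq_nonneg (2 * (k : ℤ) - 3)]
  have hl2 : -2 < 2 * (l : ℤ) - k := by nlinarith [sq_nonneg (2 * (k : ℤ) - 3)]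
  have hk : k = 1 ∨ k = 2 := by omega
  have hl : l = 0 ∨ l = 1 := by omega
  rcases hk with rfl | rfl <;> rcases hl with rfl | rfl
  · exfalso; push_cast at tz; omega
  · rw [hx, hz, hy, hw]; push_cast
    refine ⟨by norm_num, by norm_num, by norm_num, by ring⟩
  · exfalso; push_cast at tz; omega
  · exfalso; norm_num at kz

theorem main_thm (G : Subgroup (Perm (Fin 9))) [Fintype G] (hG : G = Subgroup.closure {pX, pY})
    (a : G) (ha : (a : Perm (Fin 9)) = pA) (r s : G)
    (hr : (r : Perm (Fin 9)) = pR) (hs : (s : Perm (Fin 9)) = pS)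
    (hD4card : Nat.card (Subgroup.closure {r, s} : Subgroup G) = 8)
    (ζ : ℂ) (hζ : ζ = Complex.exp (2 * Real.pi * Complex.I / 7))
    (χ₁ : (Subgroup.zpowers a : Subgroup G) →* ℂ)
    (hχ₁ : χ₁ ⟨a, Subgroup.mem_zpowers a⟩ = ζ)
    (η : (Subgroup.closure {r, s} : Subgroup G) →* ℂ)
    (hηr : η ⟨r, Subgroup.subset_closure (Set.mem_insert _ _)⟩ = -1)
    (hηs : η ⟨s, Subgroup.subset_closure (Set.mem_insert_of_mem _ rfl)⟩ = -1)
    (V : FDRep ℂ G) (hV : CategoryTheory.Simple V) (hdim : Module.finrank ℂ V = 3)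
    (c₅ : G) (hc₅ : (c₅ : Perm (Fin 9)) = pC)
    (hval : V.character c₅ = (-1 + Real.sqrt 7 * Complex.I) / 2) (g : G) :
    V.character g =
      indChar (Subgroup.zpowers a) χ₁ g - indChar (Subgroup.closure {r, s}) η g := by
  have hXG : pX ∈ G := by rw [hG]; exact Subgroup.subset_closure (by simp)
  have hYG : pY ∈ G := by rw [hG]; exact Subgroup.subset_closure (by simp)
  have hAG : pA ∈ G := ha ▸ a.2
  have hRG : pR ∈ G := hr ▸ r.2
  have hSG : pS ∈ G := hs ▸ s.2
  have hBG : pB ∈ G := G.mul_mem (G.mul_mem (G.mul_mem hXG hXG) hYG) hXG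
  have hel : ∀ p, el p ∈ G := fun p =>
    G.mul_mem (G.mul_mem (G.pow_mem hAG _) (G.pow_mem hBG _))
      (G.mul_mem (G.pow_mem hRG _) (G.pow_mem hSG _))
  set e : ℕ → G := fun p => ⟨el p, hel p⟩ with he
  have hcf : ∀ g x h : G, g * x = x * h → V.character g = V.character h := by
    intro g x h h1
    have : g = x * h * x⁻¹ := by rw [← h1]; group
    rw [this, FDRep.char_conj]
  -- equality of products of elements, by codes
  have hcode : ∀ x y : G, code x = code y → x = y := fun x y h => Subtype.ext (code_inj h)
  have hce : ∀ p, code (e p : Perm (Fin 9)) = ec p := fun p => code_el p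
  have h0 : e 0 = 1 := by
    apply hcode; rw [hce, Subgroup.coe_one, code_1]; decide +kernel
  have p2 : e 1 ^ 2 = 1 := by
    apply hcode; rw [Subgroup.coe_pow, code_pow, hce, Subgroup.coe_one, code_1]; decide +kernel
  have p3 : e 8 ^ 3 = 1 := by
    apply hcode; rw [Subgroup.coe_pow, code_pow, hce, Subgroup.coe_one, code_1]; decide +kernel
  have p4 : e 2 ^ 4 = 1 := by
    apply hcode; rw [Subgroup.coe_pow, code_pow, hce, Subgroup.coe_one, code_1]; decide +kernel
  have p7 : e 24 ^ 7 = 1 := by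
    apply hcode; rw [Subgroup.coe_pow, code_pow, hce, Subgroup.coe_one, code_1]; decide +kernel
  have p6 : e 24 ^ 6 = e 144 := by
    apply hcode; rw [Subgroup.coe_pow, code_pow, hce, hce]; decide +kernel
  have hpc : ∀ (p n q p' : ℕ), comp (pw (ec p) n) (ec q) = comp (ec q) (ec p') →
      V.character (e p ^ n) = V.character (e p') := by
    intro p n q p' h
    apply hcf _ (e q)
    apply hcode
    rw [Subgroup.coe_mul, Subgroup.coe_mul, code_mul, code_mul, Subgroup.coe_pow, code_pow,
      hce, hce, hce, h]
  have f8 : V.character (e 8 ^ 2) = V.character (e 8) := hpc 8 2 5 8 (by decide +kernel)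
  have f22 : V.character (e 2 ^ 2) = V.character (e 1) := hpc 2 2 42 1 (by decide +kernel)
  have f23 : V.character (e 2 ^ 3) = V.character (e 2) := hpc 2 3 1 2 (by decide +kernel)
  have fa2 : V.character (e 24 ^ 2) = V.character (e 24) := hpc 24 2 16 24 (by decide +kernel)
  have fa4 : V.character (e 24 ^ 4) = V.character (e 24) := hpc 24 4 8 24 (by decide +kernel)
  have fa3 : V.character (e 24 ^ 3) = V.character (e 144) := hpc 24 3 8 144 (by decide +kernel)
  have fa5 : V.character (e 24 ^ 5) = V.character (e 144) := hpc 24 5 16 144 (by decide +kernel)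
  have hu : V.character (e 24) = (-1 + Real.sqrt 7 * Complex.I) / 2 := by
    rw [← hval]
    symm
    apply hcf _ (e 23)
    apply hcode
    rw [Subgroup.coe_mul, Subgroup.coe_mul, code_mul, code_mul, hce, hce, hc₅, code_C]
    decide +kernel
  have f1 : V.character 1 = 3 := by rw [FDRep.char_one, hdim]; norm_num
  obtain ⟨k, hk⟩ := char_avg V (e 1) 2 (by norm_num) p2
  obtain ⟨m, hm⟩ := char_avg V (e 8) 3 (by norm_num) p3
  obtain ⟨l, hl⟩ := char_avg V (e 2) 4 (by norm_num) p4
  obtain ⟨n, hn⟩ := char_avg V (e 24) 7 (by norm_num) p7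
  simp only [Finset.sum_range_succ, Finset.sum_range_zero, pow_zero, pow_one, f1, f8, f22, f23,
    fa2, fa3, fa4, fa5, p6] at hk hm hl hn
  push_cast at hk hm hl hn
  -- order of the group
  have hcard : Nat.card G = 168 := by
    have := class_sum hG hel (fun _ => 1) (fun _ _ _ _ => rfl)
    rw [Finset.sum_const, Finset.card_univ, nsmul_eq_mul, mul_one] at this
    rw [Nat.card_eq_fintype_card]
    have h2 : (Fintype.card G : ℂ) = (168 : ℕ) := by rw [this]; norm_num
    exact_mod_cast h2
  have hinvt : Invertible (Nat.card G : ℂ) := invertibleOfNonzero (by rw [hcard]; norm_num)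
  have ht := FDRep.average_char_eq_finrank_invariants V
  have ho := FDRep.char_orthonormal V V
  rw [if_pos ⟨CategoryTheory.Iso.refl V⟩, hcard, inv_mul_eq_iff_eq_mul₀ (by norm_num)] at ho
  rw [hcard, inv_mul_eq_iff_eq_mul₀ (by norm_num)] at ht
  rw [class_sum hG hel _ hcf] at ht
  rw [class_sum hG hel] at ho
  swap
  · intro g x h h1
    have h2 : g⁻¹ * x = x * h⁻¹ := by
      have : g = x * h * x⁻¹ := by rw [← h1]; group
      rw [this]; group
    simp only [hcf g x h h1, hcf _ x _ h2]
  change V.character (e 0) + 21 * V.character (e 1) + 56 * V.character (e 8) +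
    42 * V.character (e 2) + 24 * V.character (e 24) + 24 * V.character (e 144) = _ at ht
  change V.character (e 0) * V.character (e 0)⁻¹ + 21 * (V.character (e 1) * V.character (e 1)⁻¹)
    + 56 * (V.character (e 8) * V.character (e 8)⁻¹)
    + 42 * (V.character (e 2) * V.character (e 2)⁻¹)
    + 24 * (V.character (e 24) * V.character (e 24)⁻¹)
    + 24 * (V.character (e 144) * V.character (e 144)⁻¹) = _ at ho
  have i1 : (e 1)⁻¹ = e 1 := by rw [inv_eq_iff_mul_eq_one, ← pow_two, p2]
  have i8 : (e 8)⁻¹ = e 8 ^ 2 := by rw [inv_eq_iff_mul_eq_one, ← pow_succ', p3]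
  have i2 : (e 2)⁻¹ = e 2 ^ 3 := by rw [inv_eq_iff_mul_eq_one, ← pow_succ', p4]
  have i24 : (e 24)⁻¹ = e 144 := by rw [inv_eq_iff_mul_eq_one, ← p6, ← pow_succ', p7]
  have i144 : (e 144)⁻¹ = e 24 := by rw [← i24, inv_inv]
  rw [i1, i8, i2, i24, i144, f8, f23, h0, inv_one, f1] at ho
  rw [h0, f1] at ht
  obtain ⟨vx, vz, vy, vw⟩ := values_aux (V.character (e 1)) (V.character (e 2)) (V.character (e 8))
    (V.character (e 24)) (V.character (e 144)) k l m n _ hu (by linear_combination hk)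
    (by linear_combination hm) (by linear_combination hl) (by linear_combination hn)
    (by push_cast at ho; linear_combination ho) (by push_cast at ht; linear_combination ht)
  -- reduce to representatives
  obtain ⟨g, hg⟩ := g
  obtain ⟨p, hp, rfl⟩ := mem_el hG hg
  obtain ⟨h6, hc⟩ := conj_rep hp
  have hc' : (⟨el p, hg⟩ : G) * e (cjIdx p) = e (cjIdx p) * e (rp (clIdx p)) := Subtype.ext hc
  rw [hcf _ _ _ hc', indChar_conj _ _ _ _ _ hc', indChar_conj _ _ _ _ _ hc']
  generalize clIdx p = c at h6
  obtain ⟨z0, z1⟩ := gauss7 ζ hζ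
  rw [he]
  simp only []
  rw [indA hG hel a ha ζ χ₁ hχ₁, indD hG hel r s hr hs hD4card η hηr hηs]
  have tA := chk_tabA
  have tD := chk_tabD
  simp only [List.range, List.range.loop, List.map, List.cons.injEq, and_true] at tA tD
  obtain ⟨A0, A1, A2, A3, A4, A5⟩ := tA
  obtain ⟨D0, D1, D2, D3, D4, D5⟩ := tD
  change V.character (e (rp c)) = _
  have hc6 : c = 0 ∨ c = 1 ∨ c = 2 ∨ c = 3 ∨ c = 4 ∨ c = 5 := by omega
  simp only [Finset.sum_range_succ, Finset.sum_range_zero]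
  rcases hc6 with rfl | rfl | rfl | rfl | rfl | rfl
  · simp only [A0, D0]; simp only [rp]; rw [h0, f1]; norm_num
  · simp only [A1, D1]; simp only [rp]; rw [vx]; norm_num
  · simp only [A2, D2]; simp only [rp]; rw [vz]; norm_num
  · simp only [A3, D3]; simp only [rp]; rw [vy]; norm_num
  · simp only [A4, D4]; simp only [rp]; rw [hu]; push_cast; linear_combination -z1
  · simp only [A5, D5]; simp only [rp]; rw [vw, hu]; push_cast; linear_combination z1 - z0

end Aux

theorem stmt0
    (G : Subgroup (Equiv.Perm (Fin 9)))
    (hG : G = Subgroup.closure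
      {c[(3 : Fin 9), 6, 7] * c[(4 : Fin 9), 5, 8], c[(1 : Fin 9), 8, 2] * c[(4 : Fin 9), 5, 6]})
    -- `a = (1,8,2,4,3,7,5)` as an element of `G`
    (a : G) (ha : (a : Equiv.Perm (Fin 9)) = c[(1 : Fin 9), 8, 2, 4, 3, 7, 5])
    -- `r`, `s` generating the dihedral group `D₄` of order 8
    (r s : G)
    (hr : (r : Equiv.Perm (Fin 9)) = c[(1 : Fin 9), 7, 3, 8] * c[(2 : Fin 9), 6, 4, 5])
    (hs : (s : Equiv.Perm (Fin 9)) =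
      c[(1 : Fin 9), 2] * c[(3 : Fin 9), 4] * c[(5 : Fin 9), 7] * c[(6 : Fin 9), 8])
    (hD4card : Nat.card (Subgroup.closure {r, s} : Subgroup G) = 8)
    -- `ζ₇ = e^{2πi/7}`, a primitive 7-th root of unity
    (ζ : ℂ) (hζ : ζ = Complex.exp (2 * Real.pi * Complex.I / 7))
    -- `χ₁` : degree-1 character of `C₇ = ⟨a⟩` with `χ₁(a) = ζ₇`
    (χ₁ : (Subgroup.zpowers a : Subgroup G) →* ℂ)
    (hχ₁ : χ₁ ⟨a, Subgroup.mem_zpowers a⟩ = ζ)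
    -- `η` : degree-1 character of `D₄` with `η(r) = η(s) = -1`
    (η : (Subgroup.closure {r, s} : Subgroup G) →* ℂ)
    (hηr : η ⟨r, Subgroup.subset_closure (Set.mem_insert _ _)⟩ = -1)
    (hηs : η ⟨s, Subgroup.subset_closure (Set.mem_insert_of_mem _ rfl)⟩ = -1)
    -- `χ₂` : the irreducible character of `G` of degree 3 taking value
    -- `(-1+√-7)/2` on the 7-cycle `(1,5,3,7,6,8,2)`
    (V : FDRep ℂ G) (hV : CategoryTheory.Simple V) (hdim : Module.finrank ℂ V = 3)
    (c₅ : G) (hc₅ : (c₅ : Equiv.Perm (Fin 9)) = c[(1 : Fin 9), 5, 3, 7, 6, 8, 2])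
    (hval : V.character c₅ = (-1 + Real.sqrt 7 * Complex.I) / 2) :
    ∀ g : G, V.character g =
      indChar (Subgroup.zpowers a) χ₁ g - indChar (Subgroup.closure {r, s}) η g := by

  exact main_thm G hG a ha r s hr hs hD4card ζ hζ χ₁ hχ₁ η hηr hηs V hV hdim c₅ hc₅ hval
end

section
/- Let G be the simple group of order 168 and let p be a prime not dividing 168. For a subgroup H of G and a character ψ of H, let e_ψ^H = (ψ(1)/|H|) Σ_{h∈H} ψ(h⁻¹)h ∈ ℤ_p[ζ₇][G]. Let C₇ = ⟨a⟩ with a = (1,8,2,4,3,7,5), and let χ₁, χ₂, χ₄ be the degree-1 characters of C₇ with χ_i(a) = ζ₇^i for i ∈ {1,2,4}. Let e₂^G be the central idempotent attached to the irreducible character of G of degree 3 denoted χ₂^G. Then e₂^G · (e_{χ₁}^{C₇} + e_{χ₂}^{C₇} + e_{χ₄}^{C₇}) = e₂^G in ℤ_p[ζ₇][G]. -/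
open scoped Classical

/-- The idempotent `e_ψ^H = (1/|H|) ∑_{h∈H} ψ(h⁻¹) h` attached to a degree-1 character `ψ`
of a subgroup `H`, as an element of the group algebra `K[G]`. -/
noncomputable def subIdem {G : Type} [Group G] [Fintype G] {K : Type} [Field K]
    (H : Subgroup G) (ψ : H → K) : MonoidAlgebra K G :=
  (Fintype.card H : K)⁻¹ • ∑ h : H, MonoidAlgebra.single (h : G) (ψ h⁻¹)

/-- The central idempotent `e_χ^G = (χ(1)/|G|) ∑_{g∈G} χ(g⁻¹) g` attached to a character `χ`
of `G` of degree `d`. -/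
noncomputable def cenIdem {G : Type} [Group G] [Fintype G] {K : Type} [Field K]
    (χ : G → K) (d : K) : MonoidAlgebra K G :=
  (d / (Fintype.card G : K)) • ∑ g : G, MonoidAlgebra.single g (χ g⁻¹)


/-- spectral projector of `A` (with `A ^ 7 = 1`) at the 7th root of unity `w` -/
noncomputable def specProj {K M : Type*} [Field K] [Ring M] [Algebra K M] (A : M) (w : K) : M :=
  (7 : K)⁻¹ • ∑ j ∈ Finset.range 7, w ^ (6 * j) • A ^ j

lemma mul_specProj {K M : Type*} [Field K] [Ring M] [Algebra K M] (A : M)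
    (hA : A ^ 7 = 1) (w : K) (hw : w ^ 7 = 1) : A * specProj A w = w • specProj A w := by
  unfold specProj
  rw [mul_smul_comm, smul_comm w]
  congr 1
  rw [Finset.mul_sum, Finset.smul_sum]
  rw [Finset.sum_range_succ, Finset.sum_range_succ' (fun j => w • w ^ (6 * j) • A ^ j)]
  congr 1
  · refine Finset.sum_congr rfl fun j _ => ?_
    rw [mul_smul_comm, ← pow_succ', smul_smul, ← pow_succ']
    congr 1
    have : 6 * (j + 1) + 1 = 6 * j + 7 := by ring
    rw [this, pow_add, hw, mul_one]
  · rw [mul_smul_comm, ← pow_succ', hA, smul_smul]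
    simp only [pow_zero, mul_zero, mul_one]
    congr 1
    have : 6 * 6 = 7 * 5 + 1 := by norm_num
    rw [this, pow_add, pow_mul, hw]
    simp

lemma pow_mul_specProj {K M : Type*} [Field K] [Ring M] [Algebra K M] (A : M)
    (hA : A ^ 7 = 1) (w : K) (hw : w ^ 7 = 1) (j : ℕ) :
    A ^ j * specProj A w = w ^ j • specProj A w := by
  induction j with
  | zero => simp
  | succ j ih =>
    rw [pow_succ, mul_assoc, mul_specProj A hA w hw, mul_smul_comm, ih, smul_smul, pow_succ']

lemma specProj_idem {K M : Type*} [Field K] [CharZero K] [Ring M] [Algebra K M] (A : M)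
    (hA : A ^ 7 = 1) (w : K) (hw : w ^ 7 = 1) : IsIdempotentElem (specProj A w) := by
  unfold IsIdempotentElem
  conv_lhs => enter [1]; unfold specProj
  rw [smul_mul_assoc, Finset.sum_mul]
  have : ∀ j ∈ Finset.range 7, w ^ (6 * j) • A ^ j * specProj A w = specProj A w := by
    intro j _
    rw [smul_mul_assoc, pow_mul_specProj A hA w hw, smul_smul, ← pow_add]
    have : 6 * j + j = 7 * j := by ring
    rw [this, pow_mul, hw]
    simp
  rw [Finset.sum_congr rfl this, Finset.sum_const, Finset.card_range, ← Nat.cast_smul_eq_nsmul K,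
    smul_smul]
  norm_num

lemma sum_specProj {K M : Type*} [Field K] [CharZero K] [Ring M] [Algebra K M] (A : M)
    (ζ : K) (hζ : IsPrimitiveRoot ζ 7) :
    ∑ k ∈ Finset.range 7, specProj A (ζ ^ k) = 1 := by
  unfold specProj
  rw [← Finset.smul_sum, Finset.sum_comm]
  have h : ∀ j ∈ Finset.range 7, ∑ k ∈ Finset.range 7, (ζ ^ k) ^ (6 * j) • A ^ j
      = if j = 0 then (7 : K) • (1 : M) else 0 := by
    intro j hj
    rw [← Finset.sum_smul]
    split_ifs with h0
    · subst h0; simp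
    · have hc : (6 * j).Coprime 7 := by
        rw [Finset.mem_range] at hj
        interval_cases j <;> first | omega | decide
      have := (hζ.pow_of_coprime _ hc).geom_sum_eq_zero (by norm_num)
      have h2 : ∀ k, (ζ ^ k) ^ (6 * j) = (ζ ^ (6 * j)) ^ k := fun k => by
        rw [← pow_mul, ← pow_mul, mul_comm]
      simp only [h2, this, zero_smul]
  rw [Finset.sum_congr rfl h]
  simp [smul_smul]

lemma nat_coeffs {K : Type*} [Field K] [CharZero K] (ζ : K) (hζ : IsPrimitiveRoot ζ 7)
    (m : ℕ → ℕ) (hs : ∑ k ∈ Finset.range 7, m k = 3)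
    (h : ∑ k ∈ Finset.range 7, (m k : K) * ζ ^ k = ζ + ζ ^ 2 + ζ ^ 4) :
    m 0 = 0 ∧ m 3 = 0 ∧ m 5 = 0 ∧ m 6 = 0 := by
  have hdeg : (minpoly ℚ ζ).natDegree = 6 := by
    rw [← Polynomial.cyclotomic_eq_minpoly_rat hζ (by norm_num), Polynomial.natDegree_cyclotomic]
    decide
  have hli := linearIndependent_pow (K := ℚ) ζ
  rw [hdeg] at hli
  rw [Fintype.linearIndependent_iff] at hli
  have hg := hζ.geom_sum_eq_zero (by norm_num)
  have key := hli ![(m 0 : ℚ) - m 6, m 1 - 1 - m 6, m 2 - 1 - m 6, m 3 - m 6, m 4 - 1 - m 6,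
    m 5 - m 6] (by
      simp only [Finset.sum_range_succ, Finset.sum_range_zero] at h hg
      simp [Fin.sum_univ_succ, Algebra.smul_def]
      linear_combination h - (m 6 : K) * hg)
  have k0 := key 0
  have k1 := key 1
  have k2 := key 2
  have k3 := key 3
  have k4 := key 4
  have k5 := key 5
  simp at k0 k1 k2 k3 k4 k5
  simp only [Finset.sum_range_succ, Finset.sum_range_zero] at hs
  have hs' : (m 0 : ℚ) + m 1 + m 2 + m 3 + m 4 + m 5 + m 6 = 3 := by exact_mod_cast (by omega)
  have h6 : (m 6 : ℚ) = 0 := by linarith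
  have h0 : (m 0 : ℚ) = 0 := by linarith
  have h3 : (m 3 : ℚ) = 0 := by linarith
  have h5 : (m 5 : ℚ) = 0 := by linarith
  exact ⟨by exact_mod_cast h0, by exact_mod_cast h3, by exact_mod_cast h5, by exact_mod_cast h6⟩

lemma specProj_sum_eq_one {K V : Type*} [Field K] [CharZero K] [AddCommGroup V] [Module K V]
    [FiniteDimensional K V] (hdim : Module.finrank K V = 3) (A : Module.End K V) (hA : A ^ 7 = 1)
    (ζ : K) (hζ : IsPrimitiveRoot ζ 7) (ht : LinearMap.trace K V A = ζ + ζ ^ 2 + ζ ^ 4) :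
    specProj A ζ + specProj A (ζ ^ 2) + specProj A (ζ ^ 4) = 1 := by
  have hw : ∀ k : ℕ, (ζ ^ k) ^ 7 = 1 := fun k => by
    rw [← pow_mul, mul_comm, pow_mul, hζ.pow_eq_one, one_pow]
  have hid := fun k => specProj_idem A hA (ζ ^ k) (hw k)
  have htr : ∀ k, LinearMap.trace K V (specProj A (ζ ^ k))
      = (Module.finrank K (LinearMap.range (specProj A (ζ ^ k))) : K) := fun k =>
    (LinearMap.IsIdempotentElem.isProj_range _ (hid k)).trace
  have hsum := sum_specProj A ζ hζ
  obtain ⟨h0, h3, h5, h6⟩ := nat_coeffs ζ hζ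
    (fun k => Module.finrank K (LinearMap.range (specProj A (ζ ^ k)))) (by
      have := congrArg (LinearMap.trace K V) hsum
      rw [map_sum, LinearMap.trace_one, hdim] at this
      simp only [htr] at this
      exact_mod_cast this) (by
      have := congrArg (fun x => LinearMap.trace K V (A * x)) hsum
      simp only [Finset.mul_sum, map_sum, mul_one, ht] at this
      rw [← this]
      refine Finset.sum_congr rfl fun k _ => ?_
      rw [mul_specProj A hA _ (hw k), map_smul, htr, smul_eq_mul, mul_comm])
  have hz : ∀ k, Module.finrank K (LinearMap.range (specProj A (ζ ^ k))) = 0 →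
      specProj A (ζ ^ k) = 0 := fun k hk =>
    LinearMap.IsIdempotentElem.eq_zero_of_trace_eq_zero (hid k) (by rw [htr, hk]; simp)
  have z0 := hz 0 h0
  have z3 := hz 3 h3
  have z5 := hz 5 h5
  have z6 := hz 6 h6
  simp only [Finset.sum_range_succ, Finset.sum_range_zero, z0, z3, z5, z6, pow_one, zero_add,
    add_zero] at hsum
  exact hsum

lemma sum_char_mul {G K V : Type*} [Group G] [Fintype G] [Field K] [AddCommGroup V] [Module K V]
    (ρ : G →* Module.End K V) (f : MonoidAlgebra K G) :
    (∑ g : G, MonoidAlgebra.single g (LinearMap.trace K V (ρ g⁻¹))) * f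
      = ∑ g : G, MonoidAlgebra.single g
        (LinearMap.trace K V (MonoidAlgebra.lift K (Module.End K V) G ρ f * ρ g⁻¹)) := by
  induction f using MonoidAlgebra.induction_linear with
  | zero => simp
  | add f g hf hg =>
    rw [mul_add, hf, hg, ← Finset.sum_add_distrib]
    refine Finset.sum_congr rfl fun x _ => ?_
    rw [map_add, add_mul, map_add, MonoidAlgebra.single_add]
  | single h r =>
    rw [Finset.sum_mul, ← Equiv.sum_comp (Equiv.mulRight h)
      (fun g => MonoidAlgebra.single g (LinearMap.trace K V
        (MonoidAlgebra.lift K (Module.End K V) G ρ (MonoidAlgebra.single h r) * ρ g⁻¹)))]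
    refine Finset.sum_congr rfl fun g _ => ?_
    rw [MonoidAlgebra.single_mul_single, MonoidAlgebra.lift_single, Equiv.coe_mulRight,
      smul_mul_assoc, ← map_mul, map_smul, smul_eq_mul, mul_comm r]
    simp

lemma lift_subIdem {G : Type} {K M : Type} [Group G] [Fintype G] [Field K] [Ring M] [Algebra K M]
    (ρ : G →* M) (a : G) (ha : orderOf a = 7) (χ : Subgroup.zpowers a →* K) (w : K)
    (hχ : χ ⟨a, Subgroup.mem_zpowers a⟩ = w) :
    MonoidAlgebra.lift K M G ρ (subIdem (Subgroup.zpowers a) χ) = specProj (ρ a) w := by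
  have hfin : IsOfFinOrder a := isOfFinOrder_of_finite a
  have hcard : Fintype.card (Subgroup.zpowers a) = 7 := by
    rw [Fintype.card_zpowers, ha]
  have hw : w ^ 7 = 1 := by
    rw [← hχ, ← map_pow, ← map_one χ]
    congr 1
    ext
    simp [← ha, pow_orderOf_eq_one]
  unfold subIdem specProj
  rw [hcard, map_smul, map_sum]
  congr 1
  · rw [← Equiv.sum_comp (finEquivZPowers hfin), ← ha, ← Fin.sum_univ_eq_sum_range
      (fun j => w ^ (6 * j) • ρ a ^ j)]
    refine Finset.sum_congr rfl fun j _ => ?_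
    rw [MonoidAlgebra.lift_single, finEquivZPowers_apply, map_pow]
    congr 1
    have e : (⟨a ^ (j : ℕ), j, zpow_natCast a j⟩ : Subgroup.zpowers a)⁻¹
        = ⟨a, Subgroup.mem_zpowers a⟩ ^ (6 * (j : ℕ)) := by
      rw [inv_eq_iff_mul_eq_one]
      ext
      simp only [Subgroup.coe_mul, Subgroup.coe_pow, Subgroup.coe_one]
      rw [← pow_add]
      have : (j : ℕ) + 6 * j = 7 * j := by ring
      rw [this, pow_mul, ← ha, pow_orderOf_eq_one, one_pow]
    rw [e, map_pow, hχ]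

/-- The coefficient ring `ℤ_p[ζ₇][G]` is realized inside the group algebra over
the cyclotomic extension `ℚ_p(ζ₇)`; the asserted identity of elements of `ℤ_p[ζ₇][G]` is an
identity in this group algebra.  The degree-3 irreducible character `χ₂^G` is pinned down by its
value `ζ₇ + ζ₇² + ζ₇⁴ = (-1+√-7)/2` on the class of the 7-cycle `(1,5,3,7,6,8,2)`. -/
theorem stmt1 (p : ℕ) [Fact p.Prime] (hp : ¬ (p ∣ 168))
    (K : Type) [Field K] [Algebra ℚ_[p] K] [IsCyclotomicExtension {7} ℚ_[p] K]
    (ζ : K) (hζ : IsPrimitiveRoot ζ 7)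
    (G : Subgroup (Equiv.Perm (Fin 9)))
    (hG : G = Subgroup.closure
      {c[(3 : Fin 9), 6, 7] * c[(4 : Fin 9), 5, 8], c[(1 : Fin 9), 8, 2] * c[(4 : Fin 9), 5, 6]})
    (a : G) (ha : (a : Equiv.Perm (Fin 9)) = c[(1 : Fin 9), 8, 2, 4, 3, 7, 5])
    -- χ_i, i ∈ {1,2,4} : the degree-1 characters of C₇ = ⟨a⟩ with χ_i(a) = ζ₇^i
    (χ₁ χ₂ χ₄ : (Subgroup.zpowers a : Subgroup G) →* K)
    (hχ₁ : χ₁ ⟨a, Subgroup.mem_zpowers a⟩ = ζ)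
    (hχ₂ : χ₂ ⟨a, Subgroup.mem_zpowers a⟩ = ζ ^ 2)
    (hχ₄ : χ₄ ⟨a, Subgroup.mem_zpowers a⟩ = ζ ^ 4)
    -- the irreducible character `χ₂^G` of degree 3, with value `(-1+√-7)/2 = ζ+ζ²+ζ⁴`
    -- on the class of `(1,5,3,7,6,8,2)`
    (V : FDRep K G) (hV : CategoryTheory.Simple V) (hdim : Module.finrank K V = 3)
    (c₅ : G) (hc₅ : (c₅ : Equiv.Perm (Fin 9)) = c[(1 : Fin 9), 5, 3, 7, 6, 8, 2])
    (hval : V.character c₅ = ζ + ζ ^ 2 + ζ ^ 4) :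
    cenIdem V.character 3 * (subIdem (Subgroup.zpowers a) χ₁ + subIdem (Subgroup.zpowers a) χ₂
      + subIdem (Subgroup.zpowers a) χ₄) = cenIdem V.character 3 := by
  have : CharZero K := charZero_of_injective_algebraMap (algebraMap ℚ_[p] K).injective
  have ho : orderOf a = 7 := by
    rw [← Subgroup.orderOf_coe, ha]
    have : Fact (Nat.Prime 7) := ⟨by norm_num⟩
    apply orderOf_eq_prime
    · set_option maxRecDepth 100000 in decide
    · decide
  have ht : c[(1 : Fin 9), 8, 2] * c[(4 : Fin 9), 5, 6] ∈ G := by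
    rw [hG]
    exact Subgroup.subset_closure (by simp)
  have hconj : c₅ = ⟨_, ht⟩ * a * (⟨_, ht⟩ : G)⁻¹ := by
    ext1
    simp only [Subgroup.coe_mul, Subgroup.coe_inv, ha, hc₅]
    decide
  have htr : LinearMap.trace K V (V.ρ a) = ζ + ζ ^ 2 + ζ ^ 4 := by
    rw [← hval, hconj, FDRep.char_conj]
    rfl
  have hA : (V.ρ a : Module.End K V) ^ 7 = 1 := by
    rw [← map_pow, ← ho, pow_orderOf_eq_one, map_one]
  have hone := specProj_sum_eq_one hdim (V.ρ a) hA ζ hζ htr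
  have hf : MonoidAlgebra.lift K (Module.End K V) G V.ρ (subIdem (Subgroup.zpowers a) χ₁
      + subIdem (Subgroup.zpowers a) χ₂ + subIdem (Subgroup.zpowers a) χ₄) = 1 := by
    rw [map_add, map_add, lift_subIdem V.ρ a ho χ₁ _ hχ₁, lift_subIdem V.ρ a ho χ₂ _ hχ₂,
      lift_subIdem V.ρ a ho χ₄ _ hχ₄]
    exact hone
  have key := sum_char_mul V.ρ (subIdem (Subgroup.zpowers a) χ₁
      + subIdem (Subgroup.zpowers a) χ₂ + subIdem (Subgroup.zpowers a) χ₄)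
  rw [hf] at key
  simp only [one_mul] at key
  unfold cenIdem
  rw [smul_mul_assoc]
  congr 1
end

section
/- Let G be the simple group of order 168 and S₄ = ⟨(2,6,4)(3,5,8), (1,5)(2,8)(3,6)(4,7)⟩ ≤ G, a subgroup isomorphic to the symmetric group of degree 4. Let η be the sign character of S₄ (the unique non-trivial degree-1 character). Then Ind_{S₄}^G(η) equals the irreducible character of G of degree 7. -/
open scoped Classical

set_option linter.unusedSimpArgs false

/-- A nonzero stable subspace of a simple representation is everything. -/
lemma simple_stable_top {G : Type} [Group G] (V : FDRep ℚ G) (hV : CategoryTheory.Simple V)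
    (W : Submodule ℚ V) (hW : ∀ g : G, ∀ w ∈ W, V.ρ g w ∈ W) (h0 : W ≠ ⊥) : W = ⊤ := by
  let σ : Representation ℚ G W :=
    { toFun := fun g => (V.ρ g).restrict (hW g)
      map_one' := by ext w; simp
      map_mul' := by intro a b; ext w; simp }
  let i : FDRep.of σ ⟶ V := (FDRep.forget₂HomLinearEquiv (FDRep.of σ) V)
    (Rep.ofHom ⟨W.subtype, fun g => by ext x; rfl⟩)
  have hi : ∀ w : W, i.hom.hom.hom w = (w : V) := fun w => rfl
  have hm : CategoryTheory.Mono i := by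
    refine (CategoryTheory.forget (FDRep ℚ G)).mono_of_mono_map ?_
    rw [CategoryTheory.mono_iff_injective]
    intro a b hab
    exact Subtype.ext hab
  have hne : i ≠ 0 := by
    intro hz
    apply h0
    rw [Submodule.eq_bot_iff]
    intro w hw
    have := hi ⟨w, hw⟩
    rw [hz] at this
    exact this.symm
  have hiso : CategoryTheory.IsIso i := CategoryTheory.isIso_of_mono_of_nonzero hne
  rw [Submodule.eq_top_iff']
  intro v
  have := (FDRep.isoToLinearEquiv (CategoryTheory.asIso i)).surjective v
  obtain ⟨w, hw⟩ := this
  have h2 : (w : V) = v := hw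
  rw [← h2]; exact w.2

/-- Weighted sums of traces count the dimension of an isotypic part. -/
lemma trace_sum {S : Type} [Group S] [Fintype S] {M : Type} [AddCommGroup M] [Module ℚ M]
    [FiniteDimensional ℚ M] (τ : S →* (M →ₗ[ℚ] M)) (l : S →* ℚ) :
    ∃ n : ℕ, (∑ s : S, l s⁻¹ * LinearMap.trace ℚ M (τ s) = Fintype.card S * n) ∧
      (n ≠ 0 → ∃ v : M, v ≠ 0 ∧ ∀ s, τ s v = l s • v) := by
  set e : M →ₗ[ℚ] M := (Fintype.card S : ℚ)⁻¹ • ∑ s : S, l s⁻¹ • τ s with he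
  have hc : (Fintype.card S : ℚ) ≠ 0 := by exact_mod_cast Fintype.card_ne_zero
  have hl : ∀ s, l s * l s⁻¹ = 1 := fun s => by rw [← map_mul]; simp
  have h1 : ∀ s v, τ s (e v) = l s • e v := by
    intro s v
    have : τ s * (∑ r : S, l r⁻¹ • τ r) = l s • ∑ r : S, l r⁻¹ • τ r := by
      rw [Finset.mul_sum, Finset.smul_sum]
      refine Fintype.sum_equiv (Equiv.mulLeft s) _ _ fun r => ?_
      simp only [Equiv.coe_mulLeft, mul_inv_rev, map_mul, smul_smul]
      rw [mul_left_comm, hl, mul_one, mul_smul_comm]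
    have h2 := LinearMap.congr_fun this v
    simp only [he, LinearMap.smul_apply, map_smul]
    rw [smul_comm, ← LinearMap.smul_apply (l s), ← h2]; rfl
  let W : Submodule ℚ M := LinearMap.range e
  have hp : LinearMap.IsProj W e := by
    constructor
    · intro x; exact ⟨x, rfl⟩
    · rintro _ ⟨x, rfl⟩
      have : ∀ m, e m = (Fintype.card S : ℚ)⁻¹ • ∑ s : S, l s⁻¹ • τ s m := by
        intro m
        rw [he]
        simp [LinearMap.sum_apply]
      rw [this (e x)]
      simp only [h1, smul_smul, mul_comm (l _⁻¹), hl, one_smul]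
      simp only [Finset.sum_const, Finset.card_univ, ← Nat.cast_smul_eq_nsmul ℚ, smul_smul]
      rw [inv_mul_cancel₀ hc, one_smul]
  refine ⟨Module.finrank ℚ W, ?_, ?_⟩
  · rw [← hp.trace, he]
    simp only [map_smul, map_sum, smul_eq_mul]
    rw [mul_inv_cancel_left₀ hc]
  · intro hn
    have : W ≠ ⊥ := fun h => hn (by rw [h]; simp)
    obtain ⟨w, ⟨x, rfl⟩, h0⟩ := Submodule.exists_mem_ne_zero_of_ne_bot this
    exact ⟨e x, h0, fun s => h1 s x⟩

/-- The sum defining an induced linear character, over coset representatives. -/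
lemma indChar_eq_sum {G : Type} [Group G] [Fintype G] (H : Subgroup G) (l : H →* ℚ) (g : G) :
    indChar H l g = ∑ q : G ⧸ H, if h : (Quotient.out q)⁻¹ * g * Quotient.out q ∈ H
      then l ⟨(Quotient.out q)⁻¹ * g * Quotient.out q, h⟩ else 0 := by
  have hc : (Fintype.card H : ℚ) ≠ 0 := by exact_mod_cast Fintype.card_ne_zero
  set F : G → ℚ := fun x => if h : x⁻¹ * g * x ∈ H then l ⟨x⁻¹ * g * x, h⟩ else 0 with hF
  have key : ∀ x : G, ∀ h : H, F (x * h) = F x := by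
    intro x h
    have e1 : (x * h)⁻¹ * g * (x * h) = (h : G)⁻¹ * (x⁻¹ * g * x) * h := by group
    by_cases hx : x⁻¹ * g * x ∈ H
    · have hx' : (x * h)⁻¹ * g * (x * h) ∈ H := by
        rw [e1]; exact H.mul_mem (H.mul_mem (H.inv_mem h.2) hx) h.2
      simp only [hF, dif_pos hx, dif_pos hx']
      have : (⟨(x * h)⁻¹ * g * (x * h), hx'⟩ : H) = h⁻¹ * ⟨x⁻¹ * g * x, hx⟩ * h :=
        Subtype.ext e1
      rw [this, map_mul, map_mul, mul_right_comm, ← map_mul]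
      simp
    · have hx' : (x * h)⁻¹ * g * (x * h) ∉ H := by
        rw [e1]
        intro hm
        apply hx
        have := H.mul_mem (H.mul_mem h.2 hm) (H.inv_mem h.2)
        convert this using 1
        group
      simp only [hF, dif_neg hx, dif_neg hx']
  have hs : ∑ x : G, F x = Fintype.card H * ∑ q : G ⧸ H, F (Quotient.out q) := by
    have hbij : Function.Bijective (fun p : (G ⧸ H) × H => Quotient.out p.1 * (p.2 : G)) := by
      constructor
      · rintro ⟨q, h⟩ ⟨q', h'⟩ he
        simp only at he
        have hq : q = q' := by
          have h1 : ((Quotient.out q * (h : G) : G) : G ⧸ H) = q := by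
            rw [QuotientGroup.mk_mul_of_mem _ h.2]; exact Quotient.out_eq q
          have h2 : ((Quotient.out q' * (h' : G) : G) : G ⧸ H) = q' := by
            rw [QuotientGroup.mk_mul_of_mem _ h'.2]; exact Quotient.out_eq q'
          rw [← h1, he, h2]
        subst hq
        simpa using he
      · intro x
        have hm : (Quotient.out (x : G ⧸ H))⁻¹ * x ∈ H := by
          rw [← QuotientGroup.eq]
          exact Quotient.out_eq _
        exact ⟨((x : G ⧸ H), ⟨_, hm⟩), by simp⟩
    rw [← (Equiv.sum_comp (Equiv.ofBijective _ hbij) F),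
      Fintype.sum_prod_type, Finset.mul_sum]
    refine Finset.sum_congr rfl fun q _ => ?_
    simp [key]
  unfold indChar
  change (Fintype.card H : ℚ)⁻¹ * ∑ x : G, F x = _
  rw [hs, inv_mul_cancel_left₀ hc]

lemma char_of_eigenvector {G : Type} [Group G] [Fintype G] (V : FDRep ℚ G)
    (hV : CategoryTheory.Simple V) (H : Subgroup G) (l : H →* ℚ)
    (hidx : Fintype.card (G ⧸ H) ≤ Module.finrank ℚ V)
    (v : V) (hv : v ≠ 0) (hl : ∀ h : H, V.ρ (h : G) v = l h • v) (g : G) :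
    V.character g = indChar H l g := by
  let b : G ⧸ H → V := fun q => V.ρ (Quotient.out q) v
  have hb : ∀ (x : G) (q : G ⧸ H) (hq : (Quotient.out q)⁻¹ * x ∈ H),
      V.ρ x v = l ⟨_, hq⟩ • b q := by
    intro x q hq
    have : x = Quotient.out q * ((Quotient.out q)⁻¹ * x) := by group
    conv_lhs => rw [this, map_mul]
    have h2 := hl ⟨_, hq⟩
    change V.ρ (Quotient.out q) (V.ρ ((Quotient.out q)⁻¹ * x) v) = _
    rw [h2, map_smul]
  have hmem : ∀ x : G, (Quotient.out (x : G ⧸ H))⁻¹ * x ∈ H := by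
    intro x
    rw [← QuotientGroup.eq]
    exact Quotient.out_eq _
  have hspan : ⊤ ≤ Submodule.span ℚ (Set.range b) := by
    rw [top_le_iff]
    apply simple_stable_top V hV
    · intro g w hw
      induction hw using Submodule.span_induction with
      | mem w hw =>
        obtain ⟨q, rfl⟩ := hw
        have : V.ρ g (b q) = V.ρ (g * Quotient.out q) v := by rw [map_mul]; rfl
        rw [this, hb _ _ (hmem _)]
        exact Submodule.smul_mem _ _ (Submodule.subset_span ⟨_, rfl⟩)
      | zero => simp
      | add x y _ _ hx hy => rw [map_add]; exact Submodule.add_mem _ hx hy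
      | smul c x _ hx => rw [map_smul]; exact Submodule.smul_mem _ _ hx
    · intro h0
      rw [Submodule.span_eq_bot] at h0
      have h1 := h0 _ ⟨((1 : G) : G ⧸ H), rfl⟩
      have h2 := hb 1 _ (hmem 1)
      rw [h1, smul_zero, map_one] at h2
      exact hv h2
  have hcard : Fintype.card (G ⧸ H) = Module.finrank ℚ V := by
    apply le_antisymm hidx
    have := finrank_range_le_card (R := ℚ) b
    rw [Set.finrank, top_le_iff.mp hspan, finrank_top] at this
    exact this
  let B := basisOfTopLeSpanOfCardEqFinrank b hspan hcard
  have hB : ∀ q, B q = b q := fun q => by simp [B]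
  rw [indChar_eq_sum]
  change LinearMap.trace ℚ V (V.ρ g) = _
  rw [LinearMap.trace_eq_matrix_trace ℚ B,
    Matrix.trace]
  refine Finset.sum_congr rfl fun q _ => ?_
  rw [Matrix.diag_apply, LinearMap.toMatrix_apply, hB]
  have h1 : V.ρ g (b q) = V.ρ (g * Quotient.out q) v := by rw [map_mul]; rfl
  rw [h1, hb _ _ (hmem _), ← hB, map_smul, B.repr_self]
  split_ifs with h
  · have hq : ((g * Quotient.out q : G) : G ⧸ H) = q := by
      conv_rhs => rw [← Quotient.out_eq q]
      symm
      apply QuotientGroup.eq.mpr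
      rwa [← mul_assoc]
    simp only [hq, Finsupp.smul_single, Finsupp.single_eq_same, smul_eq_mul, mul_one, mul_assoc]
  · have hq : ((g * Quotient.out q : G) : G ⧸ H) ≠ q := by
      intro hq
      apply h
      have := hmem (g * Quotient.out q)
      rwa [hq, ← mul_assoc] at this
    simp [hq]

lemma no_fixed {G : Type} [Group G] [Fintype G] (V : FDRep ℚ G)
    (hV : CategoryTheory.Simple V) (hd : Module.finrank ℚ V ≠ 1) (v : V)
    (h : ∀ g, V.ρ g v = v) : v = 0 := by
  by_contra hv
  apply hd
  have := simple_stable_top V hV (Submodule.span ℚ {v}) (by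
    intro g w hw
    rw [Submodule.mem_span_singleton] at hw ⊢
    obtain ⟨c, rfl⟩ := hw
    exact ⟨c, by rw [map_smul, h]⟩) (by simpa using hv)
  rw [← finrank_top ℚ V, ← this]
  exact finrank_span_singleton hv

/-- No fixed vectors for a subgroup of index at most the dimension. -/
lemma no_sub_fixed {G : Type} [Group G] [Fintype G] (V : FDRep ℚ G)
    (hV : CategoryTheory.Simple V) (hd : Module.finrank ℚ V ≠ 1) (H : Subgroup G)
    (hidx : Fintype.card (G ⧸ H) ≤ Module.finrank ℚ V)
    (v : V) (hl : ∀ h : H, V.ρ (h : G) v = v) : v = 0 := by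
  by_contra hv
  have hch := char_of_eigenvector V hV H 1 hidx v hv (fun h => by rw [hl]; simp)
  obtain ⟨n, hn, hn'⟩ := trace_sum V.ρ (1 : G →* ℚ)
  have hn0 : n = 0 := by
    by_contra h0
    obtain ⟨w, hw, hw'⟩ := hn' h0
    exact hw (no_fixed V hV hd w (fun g => by rw [hw']; simp))
  have h1 : ∀ g, 0 ≤ V.character g := by
    intro g
    rw [hch, indChar_eq_sum]
    refine Finset.sum_nonneg fun q _ => ?_
    split_ifs <;> simp
  have h2 : 0 < V.character 1 := by
    rw [hch, indChar_eq_sum]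
    simp [Fintype.card_pos]
  have h3 : ∑ g, V.character g = 0 := by
    rw [hn0] at hn
    simpa [FDRep.character, Representation.character] using hn
  have h4 := Finset.sum_pos' (fun g _ => h1 g) ⟨1, Finset.mem_univ _, h2⟩
  linarith

/-- The symmetric group on three of four points. -/
def symThree : Equiv.Perm (Fin 3) →* Equiv.Perm (Fin 4) :=
  Equiv.Perm.extendDomainHom (finSuccAboveEquiv (3 : Fin 4))

/-- The class representative of a permutation of four points. -/
def clsFour (s : Equiv.Perm (Fin 4)) : Fin 5 :=
  if s = 1 then 0 else if Equiv.Perm.sign s = 1 then (if s * s = 1 then 1 else 2)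
    else if s * s = 1 then 3 else 4

/-- Representatives of the conjugacy classes of the symmetric group on four points. -/
def repFour : Fin 5 → Equiv.Perm (Fin 4) :=
  ![1, Equiv.swap 0 1 * Equiv.swap 2 3, Equiv.swap 0 1 * Equiv.swap 1 2, Equiv.swap 0 1,
    Equiv.swap 0 1 * Equiv.swap 1 2 * Equiv.swap 2 3]

lemma conj_repFour : ∀ s : Equiv.Perm (Fin 4), ∃ k, k * s * k⁻¹ = repFour (clsFour s) := by
  decide +kernel

lemma sum_cls {S : Type} [Fintype S] (c : S → Fin 5) (F : Fin 5 → ℚ) :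
    ∑ s, F (c s) = ∑ j : Fin 5, ((Finset.univ.filter fun s => c s = j).card : ℚ) * F j := by
  rw [← Finset.sum_fiberwise' Finset.univ c F]
  simp

lemma sum_four (F : Fin 5 → ℚ) :
    ∑ s, F (clsFour s) = F 0 + 3 * F 1 + 8 * F 2 + 6 * F 3 + 6 * F 4 := by
  rw [sum_cls, Fin.sum_univ_five,
    show (Finset.univ.filter fun s => clsFour s = 0).card = 1 by decide +kernel,
    show (Finset.univ.filter fun s => clsFour s = 1).card = 3 by decide +kernel,
    show (Finset.univ.filter fun s => clsFour s = 2).card = 8 by decide +kernel,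
    show (Finset.univ.filter fun s => clsFour s = 3).card = 6 by decide +kernel,
    show (Finset.univ.filter fun s => clsFour s = 4).card = 6 by decide +kernel]
  push_cast; ring

lemma sum_three (F : Fin 5 → ℚ) :
    ∑ s, F (clsFour (symThree s)) = F 0 + 2 * F 2 + 3 * F 3 := by
  rw [sum_cls (fun s => clsFour (symThree s)), Fin.sum_univ_five,
    show (Finset.univ.filter fun s => clsFour (symThree s) = 0).card = 1 by decide +kernel,
    show (Finset.univ.filter fun s => clsFour (symThree s) = 1).card = 0 by decide +kernel,
    show (Finset.univ.filter fun s => clsFour (symThree s) = 2).card = 2 by decide +kernel,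
    show (Finset.univ.filter fun s => clsFour (symThree s) = 3).card = 3 by decide +kernel,
    show (Finset.univ.filter fun s => clsFour (symThree s) = 4).card = 0 by decide +kernel]
  push_cast; ring

/-- The sign of the class representatives. -/
def sgnFive : Fin 5 → ℤ := ![1, 1, 1, -1, -1]

lemma sgnFive_cls : ∀ s : Equiv.Perm (Fin 4),
    ((Equiv.Perm.sign s : ℤˣ) : ℤ) = sgnFive (clsFour s) := by decide +kernel

/-- The sign character with rational values. -/
def signQ : Equiv.Perm (Fin 4) →* ℚ :=
  (Int.castRingHom ℚ : ℤ →* ℚ).comp ((Units.coeHom ℤ).comp Equiv.Perm.sign)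

lemma signQ_eq (s : Equiv.Perm (Fin 4)) : signQ s = sgnFive (clsFour s) := by
  rw [← sgnFive_cls]; rfl

/-- A nontrivial linear character of the symmetric group is the sign. -/
lemma eq_signQ (l : Equiv.Perm (Fin 4) →* ℚ) (h : l ≠ 1) : l = signQ := by
  have hsw : ∀ s : Equiv.Perm (Fin 4), s.IsSwap → l s = l (Equiv.swap 0 1) := by
    rintro s ⟨i, j, hij, rfl⟩
    have hc : IsConj (Equiv.swap i j) (Equiv.swap (0 : Fin 4) 1) :=
      Equiv.Perm.isConj_swap hij (by decide)
    have := l.map_isConj hc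
    exact isConj_iff_eq.mp this
  have h2 : l (Equiv.swap 0 1) * l (Equiv.swap 0 1) = 1 := by
    rw [← map_mul]; simp
  rcases mul_self_eq_one_iff.mp h2 with h1 | h1
  · exfalso
    apply h
    refine MonoidHom.eq_of_eqOn_dense Equiv.Perm.closure_isSwap fun s hs => ?_
    rw [hsw s hs, h1]; rfl
  · refine MonoidHom.eq_of_eqOn_dense Equiv.Perm.closure_isSwap fun s hs => ?_
    rw [hsw s hs, h1]
    have : Equiv.Perm.sign s = -1 := hs.sign_eq
    simp [signQ, this]

/-- A seven-dimensional representation of the symmetric group on four points in which the two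
classes of involutions have the same trace contains a linear character. -/
lemma four_lemma {M : Type} [AddCommGroup M] [Module ℚ M]
    [FiniteDimensional ℚ M] (hM : Module.finrank ℚ M = 7)
    (τ : Equiv.Perm (Fin 4) →* (M →ₗ[ℚ] M))
    (hf : LinearMap.trace ℚ M (τ (repFour 1)) = LinearMap.trace ℚ M (τ (repFour 3))) :
    (∃ v : M, v ≠ 0 ∧ ∀ s, τ s v = v) ∨ (∃ v : M, v ≠ 0 ∧ ∀ s, τ s v = signQ s • v) := by
  by_contra hcon
  push Not at hcon
  obtain ⟨hA, hB⟩ := hcon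
  set F : Fin 5 → ℚ := fun j => LinearMap.trace ℚ M (τ (repFour j)) with hF
  have hcl : ∀ s, LinearMap.trace ℚ M (τ s) = F (clsFour s) := by
    intro s
    obtain ⟨k, hk⟩ := conj_repFour s
    simp only [hF, ← hk, map_mul]
    rw [LinearMap.trace_mul_comm, ← mul_assoc, ← map_mul]
    simp
  have hF0 : F 0 = 7 := by
    have : repFour 0 = 1 := rfl
    simp only [hF, this, map_one, LinearMap.trace_one, hM]; norm_num
  have hsi : ∀ s, signQ s⁻¹ = signQ s := by intro s; simp [signQ]
  obtain ⟨n1, e1, z1⟩ := trace_sum τ 1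
  obtain ⟨n2, e2, z2⟩ := trace_sum τ signQ
  obtain ⟨n3, e3, -⟩ := trace_sum (τ.comp symThree) 1
  obtain ⟨n4, e4, -⟩ := trace_sum (τ.comp symThree) (signQ.comp symThree)
  have hn1 : n1 = 0 := by
    by_contra h0
    obtain ⟨v, hv, hv'⟩ := z1 h0
    obtain ⟨s, hs⟩ := hA v hv
    exact hs (by rw [hv']; simp)
  have hn2 : n2 = 0 := by
    by_contra h0
    obtain ⟨v, hv, hv'⟩ := z2 h0
    obtain ⟨s, hs⟩ := hB v hv
    exact hs (hv' s)
  simp only [MonoidHom.one_apply, one_mul, MonoidHom.comp_apply, map_inv symThree, hsi, signQ_eq, hcl] at e1 e2 e3 e4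
  rw [sum_four, hn1] at e1
  rw [sum_four (fun j => (sgnFive j : ℚ) * F j), hn2] at e2
  rw [sum_three] at e3
  rw [sum_three (fun j => (sgnFive j : ℚ) * F j)] at e4
  have c3 : Fintype.card (Equiv.Perm (Fin 3)) = 6 := by decide
  rw [c3] at e3 e4
  have hf' : F 1 = F 3 := hf
  have s0 : sgnFive 0 = 1 := rfl
  have s1 : sgnFive 1 = 1 := rfl
  have s2 : sgnFive 2 = 1 := rfl
  have s3 : sgnFive 3 = -1 := rfl
  have s4 : sgnFive 4 = -1 := rfl
  simp only [s0, s1, s2, s3, s4] at e2 e4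
  push_cast at e1 e2 e3 e4
  have : (5 * n3 + 3 * n4 : ℚ) = 7 := by linarith
  have h7 : 5 * n3 + 3 * n4 = 7 := by exact_mod_cast this
  omega

/-- Coset enumeration. -/
lemma coset_enum {G : Type} [Group G] (a b x y : G)
    (hab : Subgroup.closure {a, b} = ⊤) (ha : a * a * a = 1) (hb : b * b * b = 1)
    (r1 : a * b = b * (y * x * x * y * x)) (r2 : a * (b * a) = b * b * y)
    (r3 : a * (a * b * b) = b * a * y) (r4 : b * (a * a) = a * a * (x * y * x * x * y))
    (r5 : b * (b * a) = a * b * b * x) (r6 : b * (a * b * b) = a * (x * x)) (g : G) :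
    ∃ i : Fin 7, (![1, a, b, a * a, b * a, b * b, a * b * b] i)⁻¹ * g ∈
      Subgroup.closure {x, y} := by
  set H := Subgroup.closure {x, y} with hH
  set t : Fin 7 → G := ![1, a, b, a * a, b * a, b * b, a * b * b] with ht
  have hx : x ∈ H := Subgroup.subset_closure (by simp)
  have hy : y ∈ H := Subgroup.subset_closure (by simp)
  have step : ∀ (s : G) (i j : Fin 7) (h : G), h ∈ H → s * t i = t j * h →
      ∀ g, (t i)⁻¹ * g ∈ H → (t j)⁻¹ * (s * g) ∈ H := by
    intro s i j h hh he g hg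
    have : (t j)⁻¹ * (s * g) = h * ((t i)⁻¹ * g) := by
      have e : s = t j * h * (t i)⁻¹ := by rw [← he]; group
      rw [e]; group
    rw [this]; exact H.mul_mem hh hg
  have m1 : y * x * x * y * x ∈ H :=
    H.mul_mem (H.mul_mem (H.mul_mem (H.mul_mem hy hx) hx) hy) hx
  have m2 : x * y * x * x * y ∈ H :=
    H.mul_mem (H.mul_mem (H.mul_mem (H.mul_mem hx hy) hx) hx) hy
  have sa : ∀ g, (∃ i, (t i)⁻¹ * g ∈ H) → ∃ i, (t i)⁻¹ * (a * g) ∈ H := by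
    rintro g ⟨i, hi⟩
    fin_cases i
    · exact ⟨1, step a 0 1 1 H.one_mem (by simp [ht]) g hi⟩
    · exact ⟨3, step a 1 3 1 H.one_mem (by simp [ht]) g hi⟩
    · exact ⟨2, step a 2 2 _ m1 (by simpa [ht] using r1) g hi⟩
    · exact ⟨0, step a 3 0 1 H.one_mem (by simpa [ht, mul_assoc] using ha) g hi⟩
    · exact ⟨5, step a 4 5 _ hy (by simpa [ht] using r2) g hi⟩
    · exact ⟨6, step a 5 6 1 H.one_mem (by simp [ht, mul_assoc]) g hi⟩
    · exact ⟨4, step a 6 4 _ hy (by simpa [ht] using r3) g hi⟩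
  have sb : ∀ g, (∃ i, (t i)⁻¹ * g ∈ H) → ∃ i, (t i)⁻¹ * (b * g) ∈ H := by
    rintro g ⟨i, hi⟩
    fin_cases i
    · exact ⟨2, step b 0 2 1 H.one_mem (by simp [ht]) g hi⟩
    · exact ⟨4, step b 1 4 1 H.one_mem (by simp [ht]) g hi⟩
    · exact ⟨5, step b 2 5 1 H.one_mem (by simp [ht]) g hi⟩
    · exact ⟨3, step b 3 3 _ m2 (by simpa [ht] using r4) g hi⟩
    · exact ⟨6, step b 4 6 _ hx (by simpa [ht] using r5) g hi⟩
    · exact ⟨0, step b 5 0 1 H.one_mem (by simpa [ht, mul_assoc] using hb) g hi⟩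
    · exact ⟨1, step b 6 1 _ (H.mul_mem hx hx) (by simpa [ht] using r6) g hi⟩
  have ia : a⁻¹ = a * a := by rw [inv_eq_iff_mul_eq_one, ← mul_assoc, ha]
  have ib : b⁻¹ = b * b := by rw [inv_eq_iff_mul_eq_one, ← mul_assoc, hb]
  have hg : g ∈ Subgroup.closure {a, b} := by rw [hab]; trivial
  induction hg using Subgroup.closure_induction_left with
  | one => exact ⟨0, by simp [ht, H.one_mem]⟩
  | mul_left s hs g _ ih =>
    rcases hs with rfl | rfl
    · exact sa _ ih
    · exact sb _ ih
  | inv_mul_cancel s hs g _ ih =>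
    rcases hs with rfl | rfl
    · rw [ia, mul_assoc]; exact sa _ (sa _ ih)
    · rw [ib, mul_assoc]; exact sb _ (sb _ ih)

lemma trace_conj_hom {S : Type} [Group S] {M : Type} [AddCommGroup M] [Module ℚ M]
    (τ : S →* (M →ₗ[ℚ] M)) (k s : S) :
    LinearMap.trace ℚ M (τ (k * s * k⁻¹)) = LinearMap.trace ℚ M (τ s) := by
  rw [map_mul τ, LinearMap.trace_mul_comm, ← map_mul τ]
  simp

/-- The abstract form of the theorem. -/
lemma main_abstract {G : Type} [Group G] [Fintype G] (a b x y : G)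
    (hab : Subgroup.closure {a, b} = ⊤) (ha : a * a * a = 1) (hb : b * b * b = 1)
    (r1 : a * b = b * (y * x * x * y * x)) (r2 : a * (b * a) = b * b * y)
    (r3 : a * (a * b * b) = b * a * y) (r4 : b * (a * a) = a * a * (x * y * x * x * y))
    (r5 : b * (b * a) = a * b * b * x) (r6 : b * (a * b * b) = a * (x * x))
    (hx3 : x * x * x = 1) (hy2 : y * y = 1)
    (hz1 : x * y * (x * y) ≠ 1) (hz : x * y * (x * y) * (x * y * (x * y)) = 1)
    (hfus : b * a * a * y = x * y * (x * y) * (b * a * a))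
    (H : Subgroup G) (hH : H = Subgroup.closure {x, y})
    (hiso : Nonempty (H ≃* Equiv.Perm (Fin 4)))
    (η : H →* ℚ) (hη : η ≠ 1)
    (V : FDRep ℚ G) (hV : CategoryTheory.Simple V) (hdim : Module.finrank ℚ V = 7) (g : G) :
    V.character g = indChar H η g := by
  have hcos := coset_enum a b x y hab ha hb r1 r2 r3 r4 r5 r6
  rw [← hH] at hcos
  have hx' : x ∈ H := hH ▸ Subgroup.subset_closure (by simp)
  have hy' : y ∈ H := hH ▸ Subgroup.subset_closure (by simp)
  have hgen : ∀ l : H →* ℚ, l ⟨x, hx'⟩ = 1 → l ⟨y, hy'⟩ = 1 → l = 1 := by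
    subst hH
    intro l lx ly
    ext ⟨h, hh⟩
    induction hh using Subgroup.closure_induction with
    | mem s hs =>
      rcases hs with rfl | rfl
      · exact lx
      · exact ly
    | one => exact map_one l
    | mul s t hs ht h1 h2 =>
      have := map_mul l ⟨s, hs⟩ ⟨t, ht⟩
      rw [h1, h2] at this
      simpa using this
    | inv s hs h1 =>
      have := map_inv l ⟨s, hs⟩
      rw [h1] at this
      exact this.trans (by simp)
  have hidx : Fintype.card (G ⧸ H) ≤ Module.finrank ℚ V := by
    rw [hdim]
    have := Fintype.card_le_of_surjective
      (fun i : Fin 7 => ((![1, a, b, a * a, b * a, b * b, a * b * b] i : G) : G ⧸ H)) (by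
        intro q
        obtain ⟨g, rfl⟩ := QuotientGroup.mk_surjective q
        obtain ⟨i, hi⟩ := hcos g
        exact ⟨i, QuotientGroup.eq.mpr hi⟩)
    simpa using this
  obtain ⟨φ⟩ := hiso
  -- the character η is the sign character
  have hηs : η.comp φ.symm.toMonoidHom = signQ := by
    apply eq_signQ
    intro h1
    apply hη
    ext h
    have := DFunLike.congr_fun h1 (φ h)
    simpa using this
  have hηφ : ∀ h : H, η h = signQ (φ h) := by
    intro h
    rw [← hηs]; simp
  set X : H := ⟨x, hx'⟩
  set Y : H := ⟨y, hy'⟩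
  have hX3 : X * X * X = 1 := Subtype.ext hx3
  have hY2 : Y * Y = 1 := Subtype.ext hy2
  have hηX : η X = 1 := by
    have h3 : η X ^ 3 = 1 := by rw [← map_pow, pow_three', hX3, map_one]
    exact (pow_eq_one_iff_of_ne_zero (by norm_num)).mp h3 |>.resolve_right (by
      intro h; exact absurd h.2 (by decide))
  have hηY : η Y ≠ 1 := fun h => hη (hgen η hηX h)
  let Z : H := X * Y * (X * Y)
  have hηZ : η Z = 1 := by
    have : η Y * η Y = 1 := by rw [← map_mul, hY2, map_one]
    simp only [Z, map_mul, hηX, one_mul, this]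
  have hZ1 : Z ≠ 1 := fun h => hz1 (congrArg Subtype.val h)
  have hZ2 : Z * Z = 1 := Subtype.ext hz
  have hcY : clsFour (φ Y) = 3 := by
    have h1 : Equiv.Perm.sign (φ Y) ≠ 1 := by
      intro h; apply hηY; rw [hηφ]; simp [signQ, h]
    have h2 : φ Y * φ Y = 1 := by rw [← map_mul, hY2, map_one]
    have h0 : φ Y ≠ 1 := by intro h; rw [h] at h1; simp at h1
    simp [clsFour, h0, h1, h2]
  have hcZ : clsFour (φ Z) = 1 := by
    have h1 : Equiv.Perm.sign (φ Z) = 1 := by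
      rw [hηφ] at hηZ
      rcases Int.units_eq_one_or (Equiv.Perm.sign (φ Z)) with h | h
      · exact h
      · norm_num [signQ, h] at hηZ
    have h2 : φ Z * φ Z = 1 := by rw [← map_mul, hZ2, map_one]
    have h0 : φ Z ≠ 1 := by intro h; exact hZ1 (by simpa using h)
    simp [clsFour, h0, h1, h2]
  let τ : Equiv.Perm (Fin 4) →* (V →ₗ[ℚ] V) := V.ρ.comp (H.subtype.comp φ.symm.toMonoidHom)
  have hτ : ∀ h : H, τ (φ h) = V.ρ (h : G) := by intro h; simp [τ]
  have hconj : ∀ s, LinearMap.trace ℚ V (τ (repFour (clsFour s))) = LinearMap.trace ℚ V (τ s) := by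
    intro s
    obtain ⟨k, hk⟩ := conj_repFour s
    rw [← hk, trace_conj_hom]
  have hf : LinearMap.trace ℚ V (τ (repFour 1)) = LinearMap.trace ℚ V (τ (repFour 3)) := by
    rw [← hcY, ← hcZ, hconj, hconj, hτ, hτ]
    have : (Z : G) = (b * a * a) * (Y : G) * (b * a * a)⁻¹ := by
      rw [eq_mul_inv_iff_mul_eq]; exact hfus.symm
    rw [this, trace_conj_hom]
  rcases four_lemma hdim τ hf with ⟨v, hv, h⟩ | ⟨v, hv, h⟩
  · exfalso
    apply hv
    refine no_sub_fixed V hV (by rw [hdim]; norm_num) H hidx v fun k => ?_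
    rw [← hτ, h]
  · refine char_of_eigenvector V hV H η hidx v hv (fun k => ?_) g
    rw [← hτ, h, hηφ]

theorem stmt4
    (G : Subgroup (Equiv.Perm (Fin 9)))
    (hG : G = Subgroup.closure
      {c[(3 : Fin 9), 6, 7] * c[(4 : Fin 9), 5, 8], c[(1 : Fin 9), 8, 2] * c[(4 : Fin 9), 5, 6]})
    (x y : G)
    (hx : (x : Equiv.Perm (Fin 9)) = c[(2 : Fin 9), 6, 4] * c[(3 : Fin 9), 5, 8])
    (hy : (y : Equiv.Perm (Fin 9)) =
      c[(1 : Fin 9), 5] * c[(2 : Fin 9), 8] * c[(3 : Fin 9), 6] * c[(4 : Fin 9), 7])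
    -- S₄ = ⟨x, y⟩, isomorphic to the symmetric group of degree 4
    (hiso : Nonempty ((Subgroup.closure {x, y} : Subgroup G) ≃* Equiv.Perm (Fin 4)))
    -- η : the sign character, i.e. the unique non-trivial degree-1 character of S₄
    (η : (Subgroup.closure {x, y} : Subgroup G) →* ℚ) (hη : η ≠ 1)
    -- the irreducible character of G of degree 7
    (V : FDRep ℚ G) (hV : CategoryTheory.Simple V) (hdim : Module.finrank ℚ V = 7) :
    ∀ g : G, V.character g = indChar (Subgroup.closure {x, y}) η g := by
  intro g
  have ma : c[(3 : Fin 9), 6, 7] * c[(4 : Fin 9), 5, 8] ∈ G := by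
    rw [hG]; exact Subgroup.subset_closure (by simp)
  have mb : c[(1 : Fin 9), 8, 2] * c[(4 : Fin 9), 5, 6] ∈ G := by
    rw [hG]; exact Subgroup.subset_closure (by simp)
  obtain ⟨a, ha⟩ : ∃ a : G, (a : Equiv.Perm (Fin 9)) =
    c[(3 : Fin 9), 6, 7] * c[(4 : Fin 9), 5, 8] := ⟨⟨_, ma⟩, rfl⟩
  obtain ⟨b, hb⟩ : ∃ b : G, (b : Equiv.Perm (Fin 9)) =
    c[(1 : Fin 9), 8, 2] * c[(4 : Fin 9), 5, 6] := ⟨⟨_, mb⟩, rfl⟩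
  have hab : Subgroup.closure {a, b} = ⊤ := by
    apply Subgroup.map_injective G.subtype_injective
    rw [MonoidHom.map_closure, ← MonoidHom.range_eq_map, Subgroup.range_subtype]
    conv_rhs => rw [hG]
    rw [Set.image_pair, Subgroup.subtype_apply, Subgroup.subtype_apply, ha, hb]
  clear hG
  have q1 : a * a * a = 1 := by
    apply Subtype.ext
    simp only [Subgroup.coe_mul, Subgroup.coe_one, hx, hy, ha, hb]
    decide +kernel
  have q2 : b * b * b = 1 := by
    apply Subtype.ext
    simp only [Subgroup.coe_mul, Subgroup.coe_one, hx, hy, ha, hb]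
    decide +kernel
  have r1 : a * b = b * (y * x * x * y * x) := by
    apply Subtype.ext
    simp only [Subgroup.coe_mul, Subgroup.coe_one, hx, hy, ha, hb]
    decide +kernel
  have r2 : a * (b * a) = b * b * y := by
    apply Subtype.ext
    simp only [Subgroup.coe_mul, Subgroup.coe_one, hx, hy, ha, hb]
    decide +kernel
  have r3 : a * (a * b * b) = b * a * y := by
    apply Subtype.ext
    simp only [Subgroup.coe_mul, Subgroup.coe_one, hx, hy, ha, hb]
    decide +kernel
  have r4 : b * (a * a) = a * a * (x * y * x * x * y) := by
    apply Subtype.ext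
    simp only [Subgroup.coe_mul, Subgroup.coe_one, hx, hy, ha, hb]
    decide +kernel
  have r5 : b * (b * a) = a * b * b * x := by
    apply Subtype.ext
    simp only [Subgroup.coe_mul, Subgroup.coe_one, hx, hy, ha, hb]
    decide +kernel
  have r6 : b * (a * b * b) = a * (x * x) := by
    apply Subtype.ext
    simp only [Subgroup.coe_mul, Subgroup.coe_one, hx, hy, ha, hb]
    decide +kernel
  have q3 : x * x * x = 1 := by
    apply Subtype.ext
    simp only [Subgroup.coe_mul, Subgroup.coe_one, hx, hy, ha, hb]
    decide +kernel
  have q4 : y * y = 1 := by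
    apply Subtype.ext
    simp only [Subgroup.coe_mul, Subgroup.coe_one, hx, hy, ha, hb]
    decide +kernel
  have q5 : x * y * (x * y) ≠ 1 := by
    intro h
    have h' := congrArg Subtype.val h
    simp only [Subgroup.coe_mul, Subgroup.coe_one, hx, hy] at h'
    revert h'
    decide +kernel
  have q6 : x * y * (x * y) * (x * y * (x * y)) = 1 := by
    apply Subtype.ext
    simp only [Subgroup.coe_mul, Subgroup.coe_one, hx, hy, ha, hb]
    decide +kernel
  have q7 : b * a * a * y = x * y * (x * y) * (b * a * a) := by
    apply Subtype.ext
    simp only [Subgroup.coe_mul, Subgroup.coe_one, hx, hy, ha, hb]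
    decide +kernel
  exact main_abstract a b x y hab q1 q2 r1 r2 r3 r4 r5 r6 q3 q4 q5 q6 q7
    _ rfl hiso η hη V hV hdim g
end

section
/- Let G be the simple group of order 168. Let H₁ = ⟨t₁, s₁⟩ with t₁ = (1,4,2)(5,8,7) and s₁ = (1,8,2,4,3,7,5), a subgroup of order 21 isomorphic to the semidirect product C₇ ⋊ C₃. Let η₁ be the degree-1 character of H₁ with η₁(t₁) = ζ₃² and η₁(s₁) = 1. Then Ind_{H₁}^G(η₁) equals the irreducible character of G of degree 8. -/
open scoped Classical

namespace P168

def pL : List ℕ :=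
  [36344967696, 10034050176, 17557836576, 15135479616, 30706599216, 22652920176, 5208426576,
    31516143936, 21846325296, 6547526256, 35000882256, 9772040976, 18091157376, 14866203936,
    23730402336, 4938298176, 35535345456, 9504560496, 19161907536, 14332405776, 30437360256,
    18111357456, 10856314176, 21865137696, 26963612496, 13544540256, 35825918256, 6026318976,
    14850024576, 17809436976, 6529951296, 26663356176, 31223984736, 8948762736, 36061844256,
    31428469536, 13977933936, 34921072176, 27669046656, 22305469536, 19350893136, 10222798656,
    21880792896, 31008887376, 9803216496, 27253752096, 6310613856, 13562639376, 18926216496,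
    6483633456, 23391011856, 18020333136, 26077509696, 35739866976, 31178445696, 14537802096,
    34969182576, 5711995776, 14839600656, 27985801776, 8929117536, 22354073376, 31744669776,
    9715542096, 34684159776, 31459645056, 26365482096, 19385360736, 6230803776, 23140528656,
    9487016256, 6262503456, 35519690256, 26392085376, 13245884256, 32302568496, 18877612656,
    19081095216, 35722261056, 9416693376, 26869053216, 32231343456, 22035071856, 14520165456,
    14362632816, 9000342576, 19196614176, 26711520576, 22150590816, 5509424976, 31814992656,
    30375371856, 19366548336, 14268073536, 27687145776, 5405767776, 35205367056, 23120328576,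
    23692010256, 13490358096, 30406092336, 27182372976, 35239580256, 10542723456, 5981304096,
    4886718336, 31197635856, 23673849456, 26096206416, 10525086816, 18578765856, 36023259456,
    35554157856, 22400090496, 4957943376, 28040176656, 18640700256, 13277614656, 10322516016,
    5240218656, 18658768656, 30737126976, 26176988016, 14100338016, 23494476336, 10338201936,
    36273742656, 13191509376, 22590985776, 27954071376, 30909170016, 5677528176, 18831595536,
    10007701296, 32282923296, 5169841776, 26381661456, 23422249056, 34701734736, 14568329856,
    17501283696, 22069778496, 36293387856, 26899280256, 5696340576, 10794325776, 31727125536,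
    15154176336, 5491819056, 10053240336, 26693883936, 34748052576, 17840674176, 23211352896,
    30688962576, 35250381936, 17539675776, 27741327936, 10825593696, 14049313056, 5992105776,
    22572917376, 10494559056, 15054698016, 27131348016, 17737209696, 30893484096, 35991467376]

def pC2 : List ℕ :=
  [6026318976, 8948762736, 22305469536, 27253752096, 18020333136, 5711995776, 9715542096,
    32302568496, 32231343456, 26711520576, 14268073536, 13490358096, 4886718336, 10322516016,
    26176988016, 22590985776, 32282923296, 17501283696, 23211352896, 14049313056, 17737209696]

def pC7 : List ℕ :=
  [23692010256, 10053240336, 26663356176, 17557836576, 19196614176, 26869053216, 6483633456,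
    30706599216, 34921072176, 36023259456, 13277614656, 6230803776, 10338201936, 31008887376,
    31744669776, 13245884256, 23422249056, 13544540256, 19366548336, 35250381936, 5677528176,
    26899280256, 22572917376, 10034050176]

def pH0 : List ℕ :=
  [36344967696, 10034050176, 17557836576, 15135479616, 30706599216, 22652920176, 5208426576]

def pH1 : List ℕ :=
  [31516143936, 21846325296, 6547526256, 35000882256, 9772040976, 18091157376, 14866203936]

def pH2 : List ℕ :=
  [23730402336, 4938298176, 35535345456, 9504560496, 19161907536, 14332405776, 30437360256]

def pI : ℕ := 36344967696

def el (c : ℕ) : List ℕ → Bool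
  | [] => false
  | a :: l => Nat.beq a c || el c l

def dg (a i : ℕ) : ℕ := a / 16 ^ i % 16

def mulc (a b : ℕ) : ℕ :=
  dg a (dg b 0) + dg a (dg b 1) * 16 + dg a (dg b 2) * 16 ^ 2 + dg a (dg b 3) * 16 ^ 3 +
    dg a (dg b 4) * 16 ^ 4 + dg a (dg b 5) * 16 ^ 5 + dg a (dg b 6) * 16 ^ 6 +
    dg a (dg b 7) * 16 ^ 7 + dg a (dg b 8) * 16 ^ 8

def invc (a : ℕ) : ℕ :=
  0 * 16 ^ dg a 0 + 1 * 16 ^ dg a 1 + 2 * 16 ^ dg a 2 + 3 * 16 ^ dg a 3 + 4 * 16 ^ dg a 4 +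
    5 * 16 ^ dg a 5 + 6 * 16 ^ dg a 6 + 7 * 16 ^ dg a 7 + 8 * 16 ^ dg a 8

/-- class index: orders 1, 2, 3, 4, 7 (first class), 7 (second class) -/
def cls (c : ℕ) : ℕ :=
  bif Nat.beq c pI then 0 else
  bif Nat.beq (mulc c c) pI then 1 else
  bif Nat.beq (mulc c (mulc c c)) pI then 2 else
  bif Nat.beq (mulc (mulc c c) (mulc c c)) pI then 3 else
  bif el c pC7 then 4 else 5

def tag (c : ℕ) : ℕ :=
  bif el c pH0 then 0 else bif el c pH1 then 1 else bif el c pH2 then 2 else 3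

def rep (i : ℕ) : ℕ :=
  [36344967696, 6026318976, 31516143936, 21865137696, 10034050176, 15135479616].getD i 0

def cN (i j : ℕ) : ℕ :=
  ([[0, 21, 0, 0, 0, 0], [1, 4, 8, 8, 0, 0], [0, 3, 6, 6, 3, 3], [0, 4, 8, 1, 4, 4],
    [0, 0, 7, 7, 0, 7], [0, 0, 7, 7, 7, 0]].getD i []).getD j 0

def cM (i k : ℕ) : ℕ :=
  ([[168, 0, 0], [0, 0, 0], [0, 21, 21], [0, 0, 0], [21, 0, 0], [21, 0, 0]].getD i []).getD k 0

theorem chk_nodup : pL.Nodup := by decide +kernel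

theorem chk_C2 : pL.filter (fun c => Nat.beq (cls c) 1) = pC2 := by decide +kernel

theorem chk_size : (List.range 6).map (fun i => pL.countP fun c => Nat.beq (cls c) i) =
    [1, 21, 56, 42, 24, 24] := by decide +kernel

theorem chk_gen : ([18111357456, 10542723456].all fun g => pL.all fun c =>
    el (mulc g c) pL && el (mulc (invc g) c) pL) = true := by decide +kernel

theorem chk_N : (pL.all fun z => (List.range 6).all fun j =>
    Nat.beq (pC2.countP fun x => Nat.beq (cls (mulc (invc x) z)) j) (cN (cls z) j)) = true := by
  decide +kernel

theorem chk_conj : (pL.all fun z => pL.any fun x =>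
    Nat.beq (mulc x z) (mulc (rep (cls z)) x)) = true := by
  decide +kernel

theorem chk_rep : ((List.range 6).all fun i => el (rep i) pL) = true := by
  decide +kernel

theorem chk_M : ((List.range 6).all fun i => (List.range 3).all fun k =>
    Nat.beq (pL.countP fun x => Nat.beq (tag (mulc (mulc (invc x) (rep i)) x)) k) (cM i k)) = true := by
  decide +kernel

theorem chk_tagcard : (pL.countP fun x => Nat.blt (tag x) 3) = 21 := by decide +kernel

theorem chk_tagmul : ((pH0 ++ pH1 ++ pH2).all fun x => (pH0 ++ pH1 ++ pH2).all fun y =>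
    Nat.beq (tag (mulc x y)) ((tag x + tag y) % 3)) = true := by
  decide +kernel

theorem chk_taginv : ((pH0 ++ pH1 ++ pH2).all fun x =>
    Nat.beq (tag (invc x)) ((3 - tag x) % 3)) = true := by
  decide +kernel

def pw (x : ℕ) : ℕ → ℕ
  | 0 => pI
  | n + 1 => mulc (pw x n) x

/-- the list `pL` is the Bruhat decomposition -/
theorem chk_L : ((List.range 3).flatMap fun j => (List.range 7).map fun i =>
      mulc (pw 10034050176 i) (pw 31516143936 j)) ++
    ((List.range 3).flatMap fun j => (List.range 7).flatMap fun i => (List.range 7).map fun k =>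
      mulc (mulc (mulc (pw 10034050176 i) (pw 31516143936 j)) 18111357456) (pw 10034050176 k)) =
    pL := by decide +kernel

set_option linter.unusedSectionVars false
set_option linter.unusedSimpArgs false

theorem nbeq (a b : ℕ) : Nat.beq a b = true ↔ a = b :=
  ⟨Nat.eq_of_beq_eq_true, fun h => by subst h; exact Nat.beq_refl a⟩

theorem el_iff (c : ℕ) (l : List ℕ) : el c l = true ↔ c ∈ l := by
  induction l with
  | nil => simp [el]
  | cons a l ih =>
    rw [el, Bool.or_eq_true, ih, nbeq, List.mem_cons, eq_comm]

theorem cls_lt (c : ℕ) : cls c < 6 := by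
  unfold cls
  simp only [Bool.cond_eq_ite]
  split_ifs <;> norm_num

theorem cls_zero {c : ℕ} : cls c = 0 ↔ c = pI := by
  unfold cls
  simp only [Bool.cond_eq_ite, nbeq]
  constructor
  · intro h
    by_contra hc
    rw [if_neg hc] at h
    revert h
    split_ifs <;> norm_num
  · intro h
    rw [if_pos h]

theorem cls_one {c : ℕ} : cls c = 1 ↔ c ≠ pI ∧ mulc c c = pI := by
  unfold cls
  simp only [Bool.cond_eq_ite, nbeq]
  split_ifs <;> simp_all

theorem tag_lt {c : ℕ} (h : tag c < 3) : c ∈ pH0 ++ pH1 ++ pH2 := by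
  unfold tag at h
  simp only [Bool.cond_eq_ite, el_iff] at h
  simp only [List.mem_append]
  split_ifs at h <;> simp_all

section Abstract

variable {G : Type} [Group G] [Fintype G] (code : G → ℕ)

structure Coding : Prop where
  inj : Function.Injective code
  one : code 1 = pI
  mul : ∀ x y, code (x * y) = mulc (code x) (code y)
  inv : ∀ x, code x⁻¹ = invc (code x)
  mem : ∀ x, code x ∈ pL
  surj : ∀ l ∈ pL, ∃ x, code x = l

variable {code}

theorem Coding.card (hc : Coding code) (p : ℕ → Bool) :
    (Finset.univ.filter (fun x : G => p (code x) = true)).card = pL.countP p := by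
  rw [← Finset.card_image_of_injective _ hc.inj, List.countP_eq_length_filter,
    ← List.toFinset_card_of_nodup (chk_nodup.filter _)]
  congr 1
  ext c
  simp only [Finset.mem_image, Finset.mem_filter, Finset.mem_univ, true_and, List.mem_toFinset,
    List.mem_filter]
  constructor
  · rintro ⟨x, hx, rfl⟩
    exact ⟨hc.mem x, hx⟩
  · rintro ⟨h1, h2⟩
    obtain ⟨x, rfl⟩ := hc.surj c h1
    exact ⟨x, h2, rfl⟩

theorem Coding.cls_one (hc : Coding code) (x : G) : cls (code x) = 1 ↔ x ≠ 1 ∧ x * x = 1 := by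
  rw [P168.cls_one, ← hc.mul, ← hc.one, hc.inj.ne_iff, hc.inj.eq_iff]

theorem Coding.cls_zero (hc : Coding code) (x : G) : cls (code x) = 0 ↔ x = 1 := by
  rw [P168.cls_zero, ← hc.one, hc.inj.eq_iff]

theorem Coding.count (hc : Coding code) (z : G) (j : ℕ) (hj : j < 6) :
    (Finset.univ.filter (fun x : G => cls (code x) = 1 ∧ cls (code (x⁻¹ * z)) = j)).card =
      cN (cls (code z)) j := by
  have h := chk_N
  rw [List.all_eq_true] at h
  have h1 := h _ (hc.mem z)
  rw [List.all_eq_true] at h1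
  have h2 := h1 j (List.mem_range.2 hj)
  rw [nbeq, ← chk_C2, List.countP_filter, ← hc.card] at h2
  rw [← h2]
  congr 1
  ext x
  simp [hc.mul, hc.inv, and_comm]

theorem Coding.conj (hc : Coding code) : ∃ r : ℕ → G, (∀ i < 6, code (r i) = rep i) ∧
    ∀ z, ∃ x, x * z * x⁻¹ = r (cls (code z)) := by
  have h : ∀ i, ∃ r : G, i < 6 → code r = rep i := by
    intro i
    by_cases hi : i < 6
    · have h := chk_rep
      rw [List.all_eq_true] at h
      have h1 := h i (List.mem_range.2 hi)
      rw [el_iff] at h1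
      obtain ⟨x, hx⟩ := hc.surj _ h1
      exact ⟨x, fun _ => hx⟩
    · exact ⟨1, fun h => absurd h hi⟩
  choose r hr using h
  refine ⟨r, hr, fun z => ?_⟩
  have h := chk_conj
  rw [List.all_eq_true] at h
  have h1 := h _ (hc.mem z)
  rw [List.any_eq_true] at h1
  obtain ⟨c, hcL, hx⟩ := h1
  obtain ⟨x, rfl⟩ := hc.surj _ hcL
  refine ⟨x, ?_⟩
  rw [nbeq, ← hr _ (cls_lt _), ← hc.mul, ← hc.mul, hc.inj.eq_iff] at hx
  rw [hx, mul_inv_cancel_right]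

theorem Coding.size (hc : Coding code) (i : ℕ) :
    (Finset.univ.filter (fun x : G => cls (code x) = i)).card =
      pL.countP (fun c => Nat.beq (cls c) i) := by
  rw [← hc.card]
  simp

theorem sizes : (pL.countP (fun c => Nat.beq (cls c) 0) = 1) ∧
    (pL.countP (fun c => Nat.beq (cls c) 1) = 21) ∧
    (pL.countP (fun c => Nat.beq (cls c) 2) = 56) ∧
    (pL.countP (fun c => Nat.beq (cls c) 3) = 42) ∧
    (pL.countP (fun c => Nat.beq (cls c) 4) = 24) ∧
    (pL.countP (fun c => Nat.beq (cls c) 5) = 24) := by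
  have h := chk_size
  simpa only [List.range, List.range.loop, List.map_cons, List.map_nil, List.cons.injEq,
    and_true] using h

variable {K V : Type} [Field K] [CharZero K] [AddCommGroup V] [Module K V] [FiniteDimensional K V]
  (ρ : G →* (V →ₗ[K] V))

/-- class sums -/
noncomputable def cA (code : G → ℕ) (i : ℕ) : V →ₗ[K] V :=
  ∑ g : G, if cls (code g) = i then ρ g else 0

theorem Coding.A_zero (hc : Coding code) : cA ρ code 0 = 1 := by
  unfold cA
  simp [hc.cls_zero]

theorem sum_cls (f : ℕ → K) (code : G → ℕ) : ∑ z : G, f (cls (code z)) • ρ z =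
    ∑ i ∈ Finset.range 6, f i • cA ρ code i := by
  unfold cA
  simp_rw [Finset.smul_sum]
  rw [Finset.sum_comm]
  refine Finset.sum_congr rfl fun z _ => ?_
  simp_rw [smul_ite, smul_zero]
  rw [Finset.sum_ite_eq, if_pos (Finset.mem_range.2 (cls_lt _))]

theorem Coding.T_mul (hc : Coding code) (j : ℕ) (hj : j < 6) :
    cA ρ code 1 * cA ρ code j = ∑ i ∈ Finset.range 6, (cN i j : K) • cA ρ code i := by
  rw [← sum_cls ρ (fun i => (cN i j : K))]
  have h1 : cA ρ code 1 * cA ρ code j = ∑ x : G, ∑ z : G,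
      if cls (code x) = 1 ∧ cls (code (x⁻¹ * z)) = j then ρ z else 0 := by
    unfold cA
    rw [Finset.sum_mul]
    refine Finset.sum_congr rfl fun x _ => ?_
    rw [Finset.mul_sum]
    refine Fintype.sum_equiv (Equiv.mulLeft x) _ _ fun y => ?_
    by_cases h1 : cls (code x) = 1 <;> by_cases h2 : cls (code y) = j <;> simp [h1, h2]
  rw [h1, Finset.sum_comm]
  refine Finset.sum_congr rfl fun z _ => ?_
  rw [← Finset.sum_filter, Finset.sum_const, hc.count z j hj, Nat.cast_smul_eq_nsmul]

theorem Coding.T_comm (hc : Coding code) (g : G) :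
    cA ρ code 1 * ρ g = ρ g * cA ρ code 1 := by
  unfold cA
  rw [Finset.sum_mul, Finset.mul_sum]
  refine Fintype.sum_equiv (MulAut.conj g⁻¹).toEquiv _ _ fun x => ?_
  have : cls (code ((MulAut.conj g⁻¹).toEquiv x)) = 1 ↔ cls (code x) = 1 := by
    rw [hc.cls_one, hc.cls_one]
    have e : (MulAut.conj g⁻¹).toEquiv x = MulAut.conj g⁻¹ x := rfl
    rw [e, ← map_mul, ne_eq, EmbeddingLike.map_eq_one_iff, EmbeddingLike.map_eq_one_iff]
  by_cases h : cls (code x) = 1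
  · rw [if_pos h, if_pos (this.2 h), ← map_mul, ← map_mul]
    congr 1
    simp [MulAut.conj_apply, mul_assoc]
  · rw [if_neg h, if_neg (this.not.2 h), zero_mul, mul_zero]

theorem trace_inv (f : V →ₗ[K] V) (hf : f * f = 1) :
    ∃ r : ℕ, LinearMap.trace K V f = 2 * r - (Module.finrank K V : K) := by
  have hP : IsIdempotentElem ((2 : K)⁻¹ • (1 + f)) := by
    unfold IsIdempotentElem
    rw [smul_mul_smul_comm]
    have : (1 + f) * (1 + f) = (2 : K) • (1 + f) := by
      rw [mul_add, add_mul, add_mul, hf, one_mul, one_mul, mul_one]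
      module
    rw [this, smul_smul]
    congr 1
    norm_num
  have h := (LinearMap.IsIdempotentElem.isProj_range _ hP).trace
  refine ⟨Module.finrank K (LinearMap.range ((2 : K)⁻¹ • (1 + f))), ?_⟩
  rw [← h, map_smul, map_add, LinearMap.trace_one, smul_eq_mul]
  ring

theorem Coding.trace_A (hc : Coding code) (r : ℕ → G)
    (hr : ∀ z, ∃ x, x * z * x⁻¹ = r (cls (code z))) (i : ℕ) :
    LinearMap.trace K V (cA ρ code i) =
      (pL.countP (fun c => Nat.beq (cls c) i) : ℕ) * LinearMap.trace K V (ρ (r i)) := by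
  unfold cA
  rw [← hc.size, map_sum, ← nsmul_eq_mul, ← Finset.sum_const, Finset.sum_filter]
  refine Finset.sum_congr rfl fun z _ => ?_
  split_ifs with h
  · obtain ⟨x, hx⟩ := hr z
    rw [← h, ← hx, map_mul ρ, map_mul ρ, LinearMap.trace_mul_comm, ← mul_assoc, ← map_mul ρ]
    simp
  · simp

theorem Coding.main (hc : Coding code) (hdim : Module.finrank K V = 8)
    (schur : ∀ f : V →ₗ[K] V, (∀ g, f * ρ g = ρ g * f) → f = 0 ∨ Function.Injective f)
    (r : ℕ → G) (hr : ∀ z, ∃ x, x * z * x⁻¹ = r (cls (code z))) :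
    LinearMap.trace K V (ρ (r 0)) = 8 ∧ LinearMap.trace K V (ρ (r 1)) = 0 ∧
    LinearMap.trace K V (ρ (r 2)) = -1 ∧ LinearMap.trace K V (ρ (r 3)) = 0 ∧
    LinearMap.trace K V (ρ (r 4)) = 1 ∧ LinearMap.trace K V (ρ (r 5)) = 1 := by
  have hA0 := hc.A_zero ρ
  have t1 := hc.T_mul ρ 1 (by norm_num)
  have t2 := hc.T_mul ρ 2 (by norm_num)
  have t3 := hc.T_mul ρ 3 (by norm_num)
  have t4 := hc.T_mul ρ 4 (by norm_num)
  have t5 := hc.T_mul ρ 5 (by norm_num)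
  simp only [Finset.sum_range_succ, Finset.sum_range_zero, cN, List.getD_cons_zero,
    List.getD_cons_succ, Nat.cast_zero, zero_smul, zero_add, add_zero, Nat.cast_one, one_smul,
    Nat.cast_ofNat] at t1 t2 t3 t4 t5
  have tr0 := hc.trace_A ρ r hr 0
  have tr1 := hc.trace_A ρ r hr 1
  have tr2 := hc.trace_A ρ r hr 2
  have tr3 := hc.trace_A ρ r hr 3
  have tr4 := hc.trace_A ρ r hr 4
  have tr5 := hc.trace_A ρ r hr 5
  obtain ⟨z0, z1, z2, z3, z4, z5⟩ := sizes
  rw [z0] at tr0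
  rw [z1] at tr1
  rw [z2] at tr2
  rw [z3] at tr3
  rw [z4] at tr4
  rw [z5] at tr5
  have hcomm := hc.T_comm ρ
  have hall := sum_cls ρ (fun _ => (1 : K)) code
  simp only [Finset.sum_range_succ, Finset.sum_range_zero, one_smul, zero_add] at hall
  have hinv : ∃ m : ℕ, LinearMap.trace K V (ρ (r 1)) = 2 * m - 8 := by
    have : ∃ x : G, cls (code x) = 1 := by
      have h := hc.size 1
      rw [z1] at h
      have : (Finset.univ.filter (fun x : G => cls (code x) = 1)).Nonempty := by
        rw [← Finset.card_pos, h]; norm_num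
      obtain ⟨x, hx⟩ := this
      exact ⟨x, (Finset.mem_filter.1 hx).2⟩
    obtain ⟨x, hx⟩ := this
    obtain ⟨y, hy⟩ := hr x
    rw [hx] at hy
    have hxx := ((hc.cls_one x).1 hx).2
    have : r 1 * r 1 = 1 := by
      rw [← hy]
      calc y * x * y⁻¹ * (y * x * y⁻¹) = y * (x * x) * y⁻¹ := by group
        _ = 1 := by rw [hxx]; group
    obtain ⟨m, hm⟩ := trace_inv (ρ (r 1)) (by rw [← map_mul, this, map_one])
    exact ⟨m, by rw [hm, hdim]; norm_num⟩
  generalize cA ρ code 0 = A0 at *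
  generalize cA ρ code 1 = A1 at *
  generalize cA ρ code 2 = A2 at *
  generalize cA ρ code 3 = A3 at *
  generalize cA ρ code 4 = A4 at *
  generalize cA ρ code 5 = A5 at *
  have hone : LinearMap.trace K V A0 = 8 := by rw [hA0, LinearMap.trace_one, hdim]; norm_num
  have hne : (1 : V →ₗ[K] V) ≠ 0 := by
    intro h
    rw [hA0, h, map_zero] at hone
    norm_num at hone
  -- the minimal polynomial
  have p1 : (A1 - (21 : K) • 1) * 1 = A1 - (21 : K) • A0 := by rw [mul_one, hA0]
  have t0 : A1 * A0 = A1 := by rw [hA0, mul_one]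
  have poly : A1 * ((A1 - (21 : K) • 1) * ((A1 - (-7 : K) • 1) * ((A1 - (7 : K) • 1) *
      (A1 - (-3 : K) • 1)))) = 0 := by
    have e1 : A1 - (-3 : K) • 1 = A1 + (3 : K) • A0 := by rw [hA0]; module
    rw [e1]
    simp only [sub_mul, mul_add, mul_sub, smul_mul_assoc, one_mul, mul_smul_comm, t0, t1, t2, t3,
      t4, t5, smul_add, smul_sub]
    module
  have hfac : ∀ (c : K) (f : V →ₗ[K] V), (A1 - c • 1) * f = 0 → A1 = c • 1 ∨ f = 0 := by
    intro c f hf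
    rcases schur (A1 - c • 1) (fun g => by
      rw [sub_mul, mul_sub, hcomm g, smul_mul_assoc, mul_smul_comm, one_mul, mul_one]) with h | h
    · left; exact sub_eq_zero.1 h
    · right
      ext v
      apply h
      have := LinearMap.congr_fun hf v
      simpa using this
  have cases : A1 = 0 ∨ A1 = (21 : K) • 1 ∨ A1 = (-7 : K) • 1 ∨ A1 = (7 : K) • 1 ∨
      A1 = (-3 : K) • 1 := by
    rcases hfac 0 _ (by rw [zero_smul, sub_zero]; exact poly) with h | h
    · left; rw [h, zero_smul]
    rcases hfac _ _ h with h | h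
    · exact Or.inr (Or.inl h)
    rcases hfac _ _ h with h | h
    · exact Or.inr (Or.inr (Or.inl h))
    rcases hfac _ _ h with h | h
    · exact Or.inr (Or.inr (Or.inr (Or.inl h)))
    · exact Or.inr (Or.inr (Or.inr (Or.inr (sub_eq_zero.1 h))))
  obtain ⟨m, hm⟩ := hinv
  have scal : ∀ c : ℤ, A1 = (c : K) • 1 → (21 : ℤ) * (2 * m - 8) = 8 * c := by
    intro c h
    rw [h, map_smul, ← hA0, hone, hm, smul_eq_mul] at tr1
    have : ((21 * (2 * m - 8) : ℤ) : K) = ((8 * c : ℤ) : K) := by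
      push_cast
      push_cast at tr1
      linear_combination -tr1
    exact_mod_cast this
  rcases cases with h | h | h | h | h
  · rw [h, map_zero] at tr1
    rw [hone] at tr0
    have q1 := congrArg (LinearMap.trace K V) t1
    have q2 := congrArg (LinearMap.trace K V) t2
    have q3 := congrArg (LinearMap.trace K V) t3
    have q4 := congrArg (LinearMap.trace K V) t4
    have q5 := congrArg (LinearMap.trace K V) t5
    simp only [h, zero_mul, map_zero, map_add, map_smul, smul_eq_mul, hone, tr2, tr3, tr4, tr5]
      at q1 q2 q3 q4 q5
    push_cast at *
    generalize LinearMap.trace K V (ρ (r 0)) = x0 at *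
    generalize LinearMap.trace K V (ρ (r 1)) = x1 at *
    generalize LinearMap.trace K V (ρ (r 2)) = x2 at *
    generalize LinearMap.trace K V (ρ (r 3)) = x3 at *
    generalize LinearMap.trace K V (ρ (r 4)) = x4 at *
    generalize LinearMap.trace K V (ρ (r 5)) = x5 at *
    have y3 : x3 = 0 := by linear_combination (q3 - q2) / 294
    have y2 : x2 = -1 := by linear_combination -q1 / 168 - y3
    refine ⟨by linear_combination -tr0, by linear_combination -tr1 / 21, y2, y3, ?_, ?_⟩
    · linear_combination -q5 / 168 - y2 - y3
    · linear_combination -q4 / 168 - y2 - y3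
  · exfalso
    -- trivial representation
    have hT : ∀ f : V →ₗ[K] V, A1 * f = (21 : K) • f := fun f => by
      rw [h, smul_mul_assoc, one_mul]
    rw [hT] at t1 t2 t3 t4 t5
    rw [← hA0] at h
    have y3 : A3 = (42 : K) • A0 := by
      linear_combination (norm := module) (-8⁻¹ : K) • t1 + (17 / 8 : K) • h - (56⁻¹ : K) • (t2 - t3)
    have y2 : A2 = (56 : K) • A0 := by
      linear_combination (norm := module) (21⁻¹ : K) • (t2 - t3) + (4 / 3 : K) • y3
    have y4 : A4 = (24 : K) • A0 := by
      linear_combination (norm := module)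
        (56⁻¹ : K) • ((3 : K) • t4 + t5) + (12 / 56 : K) • y2 + (16 / 56 : K) • y3
    have y5 : A5 = (24 : K) • A0 := by
      linear_combination (norm := module)
        (56⁻¹ : K) • ((3 : K) • t5 + t4) + (12 / 56 : K) • y2 + (16 / 56 : K) • y3
    have hN : ∑ z : G, ρ z = (168 : K) • 1 := by
      rw [hall, y2, y3, y4, y5, h, hA0]
      module
    have htriv : ∀ g, ρ g = 1 := by
      intro g
      have e : ρ g * ∑ z : G, ρ z = ∑ z : G, ρ z := by
        rw [Finset.mul_sum]
        simp_rw [← map_mul]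
        exact Fintype.sum_equiv (Equiv.mulLeft g) _ _ fun z => rfl
      rw [hN, mul_smul_comm, mul_one] at e
      exact smul_right_injective _ (by norm_num : (168 : K) ≠ 0) e
    have b := Module.finBasisOfFinrankEq K V hdim
    let f : V →ₗ[K] V := (b.coord 0).smulRight (b 0)
    rcases schur f (fun g => by rw [htriv, one_mul, mul_one]) with hf | hf
    · have := LinearMap.congr_fun hf (b 0)
      simp [f] at this
      exact b.ne_zero 0 this
    · have : f (b 1) = f 0 := by simp [f]
      exact b.ne_zero 1 (hf this)
  · exfalso
    have := scal (-7) (by rw [h]; norm_num)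
    omega
  · exfalso
    have := scal 7 (by rw [h]; norm_num)
    omega
  · exfalso
    have := scal (-3) (by rw [h]; norm_num)
    omega

end Abstract

section Ind

variable {G : Type} [Group G] [Fintype G] {code : G → ℕ} {K : Type} [Field K]

theorem indChar_conj (H : Subgroup G) (ψ : H → K) (y g : G) :
    indChar H ψ (y * g * y⁻¹) = indChar H ψ g := by
  unfold indChar
  congr 1
  refine Fintype.sum_equiv (Equiv.mulLeft y⁻¹) _ _ fun x => ?_
  have : x⁻¹ * (y * g * y⁻¹) * x = (y⁻¹ * x)⁻¹ * g * (y⁻¹ * x) := by group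
  have gen : ∀ a b : G, a = b → (if h : a ∈ H then ψ ⟨a, h⟩ else 0) =
      (if h : b ∈ H then ψ ⟨b, h⟩ else 0) := by
    rintro a _ rfl
    rfl
  exact gen _ _ this

/-- value of the linear character on elements with given tag -/
def wt (ζ : K) (k : ℕ) : K :=
  (if k = 0 then 1 else 0) + (if k = 1 then ζ ^ 2 else 0) + (if k = 2 then ζ ^ 4 else 0)

theorem Coding.indChar_rep (hc : Coding code) (H : Subgroup G) (η : H → K) (ζ : K)
    (hη : ∀ x, (if h : x ∈ H then η ⟨x, h⟩ else 0) = wt ζ (tag (code x)))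
    (i : ℕ) (hi : i < 6) (g : G) (hg : code g = rep i) :
    indChar H η g = (Nat.card H : K)⁻¹ *
      ((cM i 0 : K) * 1 + (cM i 1 : K) * ζ ^ 2 + (cM i 2 : K) * ζ ^ 4) := by
  unfold indChar
  rw [Nat.card_eq_fintype_card]
  congr 1
  simp_rw [hη, wt, Finset.sum_add_distrib]
  have key : ∀ k < 3, ∀ a : K, (∑ x : G, if tag (code (x⁻¹ * g * x)) = k then a else 0) =
      (cM i k : K) * a := by
    intro k hk a
    have h := chk_M
    rw [List.all_eq_true] at h
    have h1 := h i (List.mem_range.2 hi)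
    rw [List.all_eq_true] at h1
    have h2 := h1 k (List.mem_range.2 hk)
    rw [nbeq, ← hc.card] at h2
    rw [← Finset.sum_filter, Finset.sum_const, nsmul_eq_mul, ← h2]
    congr 3
    ext x
    simp only [hc.mul, hc.inv, hg, nbeq]
  rw [key 0 (by norm_num), key 1 (by norm_num), key 2 (by norm_num)]

theorem wt_mul (ζ : K) (hζ : ζ ^ 3 = 1) (a b : ℕ) (ha : a < 3) (hb : b < 3) :
    wt ζ ((a + b) % 3) = wt ζ a * wt ζ b := by
  interval_cases a <;> interval_cases b <;> simp [wt]
  · ring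
  · linear_combination (-ζ ^ 3 - 1) * hζ
  · linear_combination (-ζ ^ 3 - 1) * hζ
  · linear_combination (-ζ ^ 2 * (ζ ^ 3 + 1)) * hζ

theorem tag_mul {x y : ℕ} (hx : tag x < 3) (hy : tag y < 3) :
    tag (mulc x y) = (tag x + tag y) % 3 := by
  have h := chk_tagmul
  rw [List.all_eq_true] at h
  have h1 := h x (tag_lt hx)
  rw [List.all_eq_true] at h1
  exact (nbeq _ _).1 (h1 y (tag_lt hy))

theorem tag_inv {x : ℕ} (hx : tag x < 3) : tag (invc x) = (3 - tag x) % 3 := by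
  have h := chk_taginv
  rw [List.all_eq_true] at h
  exact (nbeq _ _).1 (h x (tag_lt hx))

theorem Coding.eta (hc : Coding code) (t s : G) (ht : code t = 31516143936)
    (hs : code s = 10034050176) (ζ : K) (hζ : ζ ^ 3 = 1)
    (hcard : Nat.card (Subgroup.closure {t, s} : Subgroup G) = 21)
    (η : (Subgroup.closure {t, s} : Subgroup G) →* K)
    (hηt : η ⟨t, Subgroup.subset_closure (Set.mem_insert _ _)⟩ = ζ ^ 2)
    (hηs : η ⟨s, Subgroup.subset_closure (Set.mem_insert_of_mem _ rfl)⟩ = 1) (x : G) :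
    (if h : x ∈ (Subgroup.closure {t, s} : Subgroup G) then η ⟨x, h⟩ else 0) =
      wt ζ (tag (code x)) := by
  have hmem : ∀ x (hx : x ∈ (Subgroup.closure {t, s} : Subgroup G)),
      tag (code x) < 3 ∧ η ⟨x, hx⟩ = wt ζ (tag (code x)) := by
    intro x hx
    induction hx using Subgroup.closure_induction with
    | mem x h =>
      rcases h with rfl | h
      · rw [hηt, ht]
        have : tag 31516143936 = 1 := by decide +kernel
        rw [this]
        simp [wt]
      · have h' : x = s := h
        subst h'
        rw [hηs, hs]
        have : tag 10034050176 = 0 := by decide +kernel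
        rw [this]
        simp [wt]
    | one =>
      have e : tag (code (1 : G)) = 0 := by
        rw [hc.one]; decide +kernel
      rw [e]
      refine ⟨by norm_num, ?_⟩
      have : η ⟨1, Subgroup.one_mem _⟩ = 1 := map_one η
      rw [this]
      simp [wt]
    | mul x y hx hy ihx ihy =>
      rw [hc.mul, tag_mul ihx.1 ihy.1]
      refine ⟨Nat.mod_lt _ (by norm_num), ?_⟩
      rw [wt_mul ζ hζ _ _ ihx.1 ihy.1, ← ihx.2, ← ihy.2, ← map_mul]
      rfl
    | inv x hx ih =>
      rw [hc.inv, tag_inv ih.1]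
      refine ⟨Nat.mod_lt _ (by norm_num), ?_⟩
      have e1 : η ⟨x⁻¹, Subgroup.inv_mem _ hx⟩ * η ⟨x, hx⟩ = 1 := by
        rw [← map_mul, ← map_one η]
        congr 1
        ext
        simp
      have e2 : wt ζ ((3 - tag (code x)) % 3) * wt ζ (tag (code x)) = 1 := by
        have h3 := ih.1
        rw [← wt_mul ζ hζ _ _ (Nat.mod_lt _ (by norm_num)) ih.1]
        have : ((3 - tag (code x)) % 3 + tag (code x)) % 3 = 0 := by omega
        rw [this]
        simp [wt]
      rw [ih.2] at e1
      have hne : wt ζ (tag (code x)) ≠ 0 := right_ne_zero_of_mul_eq_one e1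
      exact mul_right_cancel₀ hne (e1.trans e2.symm)
  have hback : ∀ x, tag (code x) < 3 → x ∈ (Subgroup.closure {t, s} : Subgroup G) := by
    have hsub : (Finset.univ.filter fun x : G => x ∈ (Subgroup.closure {t, s} : Subgroup G)) ⊆
        Finset.univ.filter fun x : G => Nat.blt (tag (code x)) 3 = true := by
      intro x hx
      rw [Finset.mem_filter] at hx ⊢
      refine ⟨Finset.mem_univ _, ?_⟩
      rw [Nat.blt_eq]
      exact (hmem x hx.2).1
    have hcd : (Finset.univ.filter fun x : G =>
        x ∈ (Subgroup.closure {t, s} : Subgroup G)).card = 21 := by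
      rw [← hcard, Nat.card_eq_fintype_card, Fintype.card_subtype]
    have heq := Finset.eq_of_subset_of_card_le hsub (by
      rw [hcd, hc.card (fun c => Nat.blt (tag c) 3), chk_tagcard])
    intro x hx
    have : x ∈ Finset.univ.filter fun x : G => Nat.blt (tag (code x)) 3 = true := by
      rw [Finset.mem_filter, Nat.blt_eq]
      exact ⟨Finset.mem_univ _, hx⟩
    rw [← heq] at this
    exact (Finset.mem_filter.1 this).2
  by_cases h : x ∈ (Subgroup.closure {t, s} : Subgroup G)
  · rw [dif_pos h, (hmem x h).2]
  · rw [dif_neg h]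
    have h3 : ¬ tag (code x) < 3 := fun h' => h (hback x h')
    simp only [wt]
    rw [if_neg (by omega), if_neg (by omega), if_neg (by omega)]
    simp

end Ind

section Perm

/-- base 16 code of a permutation -/
def pcode (σ : Equiv.Perm (Fin 9)) : ℕ := ∑ i : Fin 9, (σ i).val * 16 ^ i.val

theorem dg_pcode (σ : Equiv.Perm (Fin 9)) (i : Fin 9) : dg (pcode σ) i.val = (σ i).val := by
  have h : ∀ i, (σ i).val < 9 := fun i => (σ i).isLt
  have h0 := h 0
  have h1 := h 1
  have h2 := h 2
  have h3 := h 3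
  have h4 := h 4
  have h5 := h 5
  have h6 := h 6
  have h7 := h 7
  have h8 := h 8
  have e : pcode σ = (σ 0).val + (σ 1).val * 16 + (σ 2).val * 256 + (σ 3).val * 4096 +
      (σ 4).val * 65536 + (σ 5).val * 1048576 + (σ 6).val * 16777216 + (σ 7).val * 268435456 +
      (σ 8).val * 4294967296 := by
    simp [pcode, Fin.sum_univ_succ, Fin.succ]
    ring
  rw [e]
  unfold dg
  fin_cases i <;> simp <;> omega

theorem pcode_inj : Function.Injective pcode := by
  intro σ τ h
  ext i
  rw [← dg_pcode, ← dg_pcode, h]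

theorem pcode_mul (σ τ : Equiv.Perm (Fin 9)) : pcode (σ * τ) = mulc (pcode σ) (pcode τ) := by
  have e : mulc (pcode σ) (pcode τ) =
      ∑ i : Fin 9, dg (pcode σ) (dg (pcode τ) i.val) * 16 ^ i.val := by
    simp [mulc, Fin.sum_univ_succ, Fin.succ]
    ring
  rw [e]
  unfold pcode
  refine Finset.sum_congr rfl fun i _ => ?_
  rw [← pcode, ← pcode, dg_pcode, dg_pcode]
  rfl

theorem pcode_inv (σ : Equiv.Perm (Fin 9)) : pcode σ⁻¹ = invc (pcode σ) := by
  have e : invc (pcode σ) = ∑ i : Fin 9, i.val * 16 ^ dg (pcode σ) i.val := by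
    simp [invc, Fin.sum_univ_succ, Fin.succ]
    ring
  rw [e]
  rw [pcode, ← Equiv.sum_comp σ]
  refine Finset.sum_congr rfl fun i _ => ?_
  rw [dg_pcode]
  simp

theorem pcode_one : pcode 1 = pI := by decide +kernel

theorem pcode_a : pcode (c[(3 : Fin 9), 6, 7] * c[(4 : Fin 9), 5, 8]) = 18111357456 := by
  decide +kernel
theorem pcode_b : pcode (c[(1 : Fin 9), 8, 2] * c[(4 : Fin 9), 5, 6]) = 10542723456 := by
  decide +kernel
theorem pcode_t : pcode (c[(1 : Fin 9), 4, 2] * c[(5 : Fin 9), 8, 7]) = 31516143936 := by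
  decide +kernel
theorem pcode_s : pcode (c[(1 : Fin 9), 8, 2, 4, 3, 7, 5]) = 10034050176 := by
  decide +kernel

theorem coding_G (G : Subgroup (Equiv.Perm (Fin 9))) [Fintype G]
    (hG : G = Subgroup.closure
      {c[(3 : Fin 9), 6, 7] * c[(4 : Fin 9), 5, 8], c[(1 : Fin 9), 8, 2] * c[(4 : Fin 9), 5, 6]})
    (t s : G) (ht : pcode t = 31516143936) (hs : pcode s = 10034050176) :
    Coding (fun g : G => pcode g) where
  inj := fun x y h => Subtype.ext (pcode_inj h)
  one := pcode_one
  mul x y := pcode_mul _ _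
  inv x := pcode_inv _
  mem := by
    have hg : ∀ c ∈ pL, ∀ g, g ∈ [18111357456, 10542723456] →
        mulc g c ∈ pL ∧ mulc (invc g) c ∈ pL := by
      intro c hcl g hgl
      have h := chk_gen
      rw [List.all_eq_true] at h
      have h1 := h g hgl
      rw [List.all_eq_true] at h1
      have h2 := h1 c hcl
      rwa [Bool.and_eq_true, el_iff, el_iff] at h2
    have hgen : ∀ x ∈ ({c[(3 : Fin 9), 6, 7] * c[(4 : Fin 9), 5, 8],
        c[(1 : Fin 9), 8, 2] * c[(4 : Fin 9), 5, 6]} : Set (Equiv.Perm (Fin 9))),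
        pcode x ∈ [18111357456, 10542723456] := by
      rintro x (rfl | h)
      · rw [pcode_a]; simp
      · rw [Set.mem_singleton_iff.1 h, pcode_b]; simp
    have main : ∀ x ∈ Subgroup.closure ({c[(3 : Fin 9), 6, 7] * c[(4 : Fin 9), 5, 8],
        c[(1 : Fin 9), 8, 2] * c[(4 : Fin 9), 5, 6]} : Set (Equiv.Perm (Fin 9))),
        pcode x ∈ pL := by
      intro x hx
      induction hx using Subgroup.closure_induction_left with
      | one => rw [pcode_one, ← el_iff]; decide +kernel
      | mul_left x hx y hy ih => rw [pcode_mul]; exact (hg _ ih _ (hgen x hx)).1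
      | inv_mul_cancel x hx y hy ih =>
        rw [pcode_mul, pcode_inv]; exact (hg _ ih _ (hgen x hx)).2
    rintro ⟨x, hx⟩
    exact main x (hG ▸ hx)
  surj := by
    have ha : ∃ a : G, pcode a = 18111357456 :=
      ⟨⟨c[(3 : Fin 9), 6, 7] * c[(4 : Fin 9), 5, 8], by
        rw [hG]; exact Subgroup.subset_closure (Set.mem_insert _ _)⟩, pcode_a⟩
    obtain ⟨a, ha⟩ := ha
    have hpw : ∀ (x : G) (n : ℕ), pcode ((x ^ n : G) : Equiv.Perm (Fin 9)) = pw (pcode x) n := by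
      intro x n
      induction n with
      | zero => rw [pow_zero]; exact pcode_one
      | succ n ih => rw [pow_succ, Subgroup.coe_mul, pcode_mul, ih, pw]
    intro l hl
    rw [← chk_L, List.mem_append] at hl
    simp only [List.mem_flatMap, List.mem_map] at hl
    rcases hl with ⟨j, -, i, -, rfl⟩ | ⟨j, -, i, -, k, -, rfl⟩
    · refine ⟨s ^ i * t ^ j, ?_⟩
      simp only [Subgroup.coe_mul, pcode_mul, hpw, hs, ht]
    · refine ⟨s ^ i * t ^ j * a * s ^ k, ?_⟩
      simp only [Subgroup.coe_mul, pcode_mul, hpw, hs, ht, ha]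

end Perm

theorem schur_fdrep {K G : Type} [Field K] [Group G] (V : FDRep K G)
    (hV : CategoryTheory.Simple V) (f : V →ₗ[K] V) (hf : ∀ g, f * V.ρ g = V.ρ g * f) :
    f = 0 ∨ Function.Injective f := by
  let F : V ⟶ V := ⟨CategoryTheory.InducedCategory.homMk (ModuleCat.ofHom f), fun g => by
    ext1
    exact hf g⟩
  by_cases h : F = 0
  · left
    have : F.hom.hom.hom = 0 := by rw [h]; rfl
    exact this
  · right
    have : CategoryTheory.IsIso F := CategoryTheory.isIso_of_hom_simple h
    have e := (FDRep.isoToLinearEquiv (CategoryTheory.asIso F)).injective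
    exact e

end P168

/-- `ℚ(ζ₃)` is realized as a cyclotomic extension `K` of `ℚ`. -/
theorem stmt5
    (K : Type) [Field K] [Algebra ℚ K] [IsCyclotomicExtension {3} ℚ K]
    (ζ : K) (hζ : IsPrimitiveRoot ζ 3)
    (G : Subgroup (Equiv.Perm (Fin 9)))
    (hG : G = Subgroup.closure
      {c[(3 : Fin 9), 6, 7] * c[(4 : Fin 9), 5, 8], c[(1 : Fin 9), 8, 2] * c[(4 : Fin 9), 5, 6]})
    (t₁ s₁ : G)
    (ht₁ : (t₁ : Equiv.Perm (Fin 9)) = c[(1 : Fin 9), 4, 2] * c[(5 : Fin 9), 8, 7])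
    (hs₁ : (s₁ : Equiv.Perm (Fin 9)) = c[(1 : Fin 9), 8, 2, 4, 3, 7, 5])
    -- H₁ = ⟨t₁, s₁⟩ has order 21 (≅ C₇ ⋊ C₃)
    (hcard : Nat.card (Subgroup.closure {t₁, s₁} : Subgroup G) = 21)
    -- η₁ : the degree-1 character of H₁ with η₁(t₁) = ζ₃², η₁(s₁) = 1
    (η₁ : (Subgroup.closure {t₁, s₁} : Subgroup G) →* K)
    (hηt : η₁ ⟨t₁, Subgroup.subset_closure (Set.mem_insert _ _)⟩ = ζ ^ 2)
    (hηs : η₁ ⟨s₁, Subgroup.subset_closure (Set.mem_insert_of_mem _ rfl)⟩ = 1)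
    -- the irreducible character of G of degree 8
    (V : FDRep K G) (hV : CategoryTheory.Simple V) (hdim : Module.finrank K V = 8) :
    ∀ g : G, V.character g = indChar (Subgroup.closure {t₁, s₁}) η₁ g := by
  have hchar : CharZero K := algebraRat.charZero K
  have htc : P168.pcode t₁ = 31516143936 := by rw [ht₁]; exact P168.pcode_t
  have hsc : P168.pcode s₁ = 10034050176 := by rw [hs₁]; exact P168.pcode_s
  have hc := P168.coding_G G hG t₁ s₁ htc hsc
  have hz3 : ζ ^ 3 = 1 := hζ.pow_eq_one
  have hz : ζ ^ 2 + ζ + 1 = 0 := by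
    have hne : ζ - 1 ≠ 0 := sub_ne_zero.2 (hζ.ne_one (by norm_num))
    apply mul_left_cancel₀ hne
    linear_combination hz3
  obtain ⟨r, hr, hconj⟩ := hc.conj
  have hη := hc.eta t₁ s₁ htc hsc ζ hz3 hcard η₁ hηt hηs
  obtain ⟨c0, c1, c2, c3, c4, c5⟩ :=
    hc.main V.ρ hdim (P168.schur_fdrep V hV) r hconj
  intro g
  obtain ⟨x, hx⟩ := hconj g
  rw [← FDRep.char_conj V g x, hx]
  have e : indChar (Subgroup.closure {t₁, s₁}) η₁ g =
      indChar (Subgroup.closure {t₁, s₁}) η₁ (r (P168.cls (P168.pcode g))) := by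
    rw [← hx, P168.indChar_conj]
  refine Eq.trans ?_ e.symm
  have hlt := P168.cls_lt (P168.pcode g)
  rw [hc.indChar_rep _ _ ζ hη _ hlt _ (hr _ hlt), hcard]
  have hch : ∀ y, V.character y = LinearMap.trace K V (V.ρ y) := fun _ => rfl
  rw [hch]
  generalize P168.cls (P168.pcode g) = i at hlt
  have hz4 : ζ ^ 4 = ζ := by linear_combination ζ * hz3
  interval_cases i
  · rw [c0]; norm_num [P168.cM]
  · rw [c1]; norm_num [P168.cM]
  · rw [c2]
    norm_num [P168.cM]
    rw [hz4]
    linear_combination -hz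
  · rw [c3]; norm_num [P168.cM]
  · rw [c4]; norm_num [P168.cM]
  · rw [c5]; norm_num [P168.cM]
end
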